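/- Let G be a simple connected positively curved (in the Lin–Lu–Yau sense) planar graph with minimum degree at least 3, drawn in the plane, let x be a vertex of maximum degree with deg(x) ≥ 18, and let Γ(x) = {v_0, v_1, …, v_{t−1}} be the neighbors of x in clockwise order (indices taken modulo t). Then there exist no indices i, j such that v_i v_j forms an ℓ-cap with ℓ ∉ {1, 2, 4}. -/

import Mathlib

open Filter Set

variable {V : Type*}

-- The `α`-lazy random walk distribution at vertex `x`.
open Classical in
noncomputable def lazyWalk (G : SimpleGraph V) [G.LocallyFinite] (α : ℝ) (x : V) : V → ℝ :=
  fun v => if v = x then α else if G.Adj x v then (1 - α) / (G.degree x : ℝ) else 0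

/-- `A` is a coupling between the finitely supported distributions `m₁` and `m₂`. -/
def IsCoupling (m₁ m₂ : V → ℝ) (A : V → V → ℝ) : Prop :=
  (Function.support fun p : V × V => A p.1 p.2).Finite ∧
  (∀ x y, 0 ≤ A x y ∧ A x y ≤ 1) ∧
  (∀ x, ∑ᶠ y, A x y = m₁ x) ∧
  (∀ y, ∑ᶠ x, A x y = m₂ y)

/-- The transportation (Wasserstein) distance between two distributions on `V`,
with respect to the graph distance of `G`. -/
noncomputable def transportDist (G : SimpleGraph V) (m₁ m₂ : V → ℝ) : ℝ :=
  sInf {w : ℝ | ∃ A : V → V → ℝ, IsCoupling m₁ m₂ A ∧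
    w = ∑ᶠ p : V × V, A p.1 p.2 * (G.dist p.1 p.2 : ℝ)}

/-- The `α`-Ricci curvature `κ_α(x,y)`. -/
noncomputable def alphaRicci (G : SimpleGraph V) [G.LocallyFinite] (α : ℝ) (x y : V) : ℝ :=
  1 - transportDist G (lazyWalk G α x) (lazyWalk G α y) / (G.dist x y : ℝ)

/-- `κ` is the Lin–Lu–Yau Ricci curvature of the pair `(x,y)`:
the limit of `κ_α(x,y)/(1-α)` as `α → 1⁻`. -/
def HasLLYCurv (G : SimpleGraph V) [G.LocallyFinite] (x y : V) (κ : ℝ) : Prop :=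
  Tendsto (fun α : ℝ => alphaRicci G α x y / (1 - α)) (nhdsWithin 1 (Set.Iio 1)) (nhds κ)

/-- `G` is positively curved: every edge has positive Lin–Lu–Yau Ricci curvature. -/
def PositivelyCurved (G : SimpleGraph V) [G.LocallyFinite] : Prop :=
  ∀ ⦃x y : V⦄, G.Adj x y → ∃ κ : ℝ, 0 < κ ∧ HasLLYCurv G x y κ

/-- `G` is planar: it admits a topological embedding in the plane, i.e. an injective
placement of the vertices together with arcs for the edges, where arcs are injective
continuous curves joining the endpoints, not passing through any other vertex, and
two arcs of distinct edges meet only in common endpoints. -/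
def IsPlanar (G : SimpleGraph V) : Prop :=
  ∃ (f : V → ℝ × ℝ) (e : ∀ u v : V, G.Adj u v → Set.Icc (0:ℝ) 1 → ℝ × ℝ),
    Function.Injective f ∧
    (∀ u v (h : G.Adj u v), Continuous (e u v h)) ∧
    (∀ u v (h : G.Adj u v), Function.Injective (e u v h)) ∧
    (∀ u v (h : G.Adj u v),
      e u v h ⟨0, Set.left_mem_Icc.mpr zero_le_one⟩ = f u ∧
      e u v h ⟨1, Set.right_mem_Icc.mpr zero_le_one⟩ = f v) ∧
    (∀ u v (h : G.Adj u v) (w : V), w ≠ u → w ≠ v → f w ∉ Set.range (e u v h)) ∧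
    (∀ u v (h : G.Adj u v) (u' v' : V) (h' : G.Adj u' v'), ({u, v} : Set V) ≠ {u', v'} →
      Set.range (e u v h) ∩ Set.range (e u' v' h') ⊆ (f '' {u, v}) ∩ (f '' {u', v'}))

/-- Given a vertex `x` whose neighbors are enumerated in clockwise order by `v`
(indices modulo the degree of `x`, encoded by the periodicity of `v`),
`v k` and `v (k+ℓ)` form an `ℓ`-cap: either `v k v (k+ℓ)` is an edge (`ℓ`-arc), or
there is a vertex `z ≠ x` adjacent to both `v k` and `v (k+ℓ)` but to no `v (k+i)`
with `1 ≤ i ≤ ℓ-1`. -/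
def IsCap (G : SimpleGraph V) (x : V) (v : ℕ → V) (k ℓ : ℕ) : Prop :=
  G.Adj (v k) (v (k + ℓ)) ∨
  ∃ z : V, z ≠ x ∧ G.Adj (v k) z ∧ G.Adj (v (k + ℓ)) z ∧
    ∀ i : ℕ, 1 ≤ i → i ≤ ℓ - 1 → ¬ G.Adj (v (k + i)) z


/-- Continuous logarithm for nonvanishing functions on `ℝ × ℝ`. -/
lemma exists_lift_sq (F : ℝ × ℝ → ℂ) (hF : Continuous F) (h0 : ∀ p, F p ≠ 0) :
    ∃ L : ℝ × ℝ → ℂ, Continuous L ∧ ∀ p, Complex.exp (L p) = F p := by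
  obtain ⟨L, ⟨_, hL⟩, _⟩ := Complex.isCoveringMapOn_exp.existsUnique_continuousMap_lifts
    (A := ℝ × ℝ) ⟨F, hF⟩ (a₀ := (0, 0)) (e₀ := Complex.log (F (0,0)))
    (by simp [Complex.exp_log (h0 _)]) (by intro p; exact h0 p)
  exact ⟨L, L.continuous, fun p => congrFun hL p⟩

/-- Two continuous logarithms on `ℝ` have the same increments. -/
lemma lift_unique (A B : ℝ → ℂ) (hA : Continuous A) (hB : Continuous B)
    (h : ∀ s, Complex.exp (A s) = Complex.exp (B s)) : A 1 - A 0 = B 1 - B 0 := by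
  have h1 : ∀ s, ∃ n : ℤ, A s = B s + n * (2 * Real.pi * Complex.I) :=
    fun s => Complex.exp_eq_exp_iff_exists_int.1 (h s)
  choose n hn using h1
  have hpi : (2 * Real.pi * Complex.I : ℂ) ≠ 0 := Complex.two_pi_I_ne_zero
  have hc : Continuous fun s => ((n s : ℤ) : ℝ) := by
    have : (fun s => ((n s : ℤ) : ℝ)) = fun s => ((A s - B s) / (2 * Real.pi * Complex.I)).re := by
      funext s
      rw [hn s, add_sub_cancel_left, mul_div_cancel_right₀ _ hpi]
      simp
    rw [this]; fun_prop
  have hc' : Continuous n := by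
    have := Int.isClosedEmbedding_coe_real.isEmbedding.continuous_iff (f := n)
    exact this.2 hc
  have : n 1 = n 0 := PreconnectedSpace.constant inferInstance hc'
  rw [hn 1, hn 0, this]; ring

/-- Increment of the logarithm of `γ - w` along `γ`. -/
lemma exists_incr (w : ℂ) (γ : ℝ → ℂ) (hγ : Continuous γ) (h : ∀ s, γ s ≠ w) :
    ∃ D : ℂ, ∀ A : ℝ → ℂ, Continuous A → (∀ s, Complex.exp (A s) = γ s - w) → A 1 - A 0 = D := by
  obtain ⟨L, hL, hL'⟩ := exists_lift_sq (fun p => γ p.1 - w) (by fun_prop)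
    (fun p => sub_ne_zero.2 (h _))
  refine ⟨L (1, 0) - L (0, 0), fun A hA hA' => ?_⟩
  exact lift_unique A (fun s => L (s, 0)) hA (by fun_prop) (fun s => by rw [hA', hL'])

open Classical in
noncomputable def incr (w : ℂ) (γ : ℝ → ℂ) : ℂ :=
  if h : Continuous γ ∧ ∀ s, γ s ≠ w then (exists_incr w γ h.1 h.2).choose else 0

lemma incr_spec {w : ℂ} {γ : ℝ → ℂ} (hγ : Continuous γ) (h : ∀ s, γ s ≠ w)
    (A : ℝ → ℂ) (hA : Continuous A) (hA' : ∀ s, Complex.exp (A s) = γ s - w) :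
    A 1 - A 0 = incr w γ := by
  have h' : Continuous γ ∧ ∀ s, γ s ≠ w := ⟨hγ, h⟩
  rw [incr, dif_pos h']
  exact (exists_incr w γ h'.1 h'.2).choose_spec A hA hA'

lemma incr_exp {w : ℂ} {γ : ℝ → ℂ} (hγ : Continuous γ) (h : ∀ s, γ s ≠ w) :
    Complex.exp (incr w γ) * (γ 0 - w) = γ 1 - w := by
  obtain ⟨L, hL, hL'⟩ := exists_lift_sq (fun p => γ p.1 - w) (by fun_prop)
    (fun p => sub_ne_zero.2 (h _))
  rw [← incr_spec hγ h (fun s => L (s, 0)) (by fun_prop) (fun s => hL' _)]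
  have h0 := hL' (0, 0)
  have h1 := hL' (1, 0)
  simp only at h0 h1 ⊢
  rw [Complex.exp_sub, h0, h1, div_mul_cancel₀]
  exact sub_ne_zero.2 (h _)

lemma incr_square {γ δ : ℝ → ℂ} (hγ : Continuous γ) (hδ : Continuous δ)
    (h : ∀ s t, γ s ≠ δ t) :
    incr (δ 0) γ + incr (γ 1) δ = incr (γ 0) δ + incr (δ 1) γ := by
  obtain ⟨L, hL, hL'⟩ := exists_lift_sq (fun p => γ p.1 - δ p.2) (by fun_prop)
    (fun p => sub_ne_zero.2 (h _ _))
  have e1 := incr_spec hγ (fun s => h s 0) (fun s => L (s, 0)) (by fun_prop) (fun s => hL' _)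
  have e2 := incr_spec hγ (fun s => h s 1) (fun s => L (s, 1)) (by fun_prop) (fun s => hL' _)
  have e3 := incr_spec hδ (fun s => (h 0 s).symm) (fun s => L (0, s) + Real.pi * Complex.I)
    (by fun_prop) (fun s => by rw [Complex.exp_add, hL', Complex.exp_pi_mul_I]; ring)
  have e4 := incr_spec hδ (fun s => (h 1 s).symm) (fun s => L (1, s) + Real.pi * Complex.I)
    (by fun_prop) (fun s => by rw [Complex.exp_add, hL', Complex.exp_pi_mul_I]; ring)
  rw [← e1, ← e2, ← e3, ← e4]; ring

/-- `K₅` has no drawing in which independent edges are disjoint. -/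
theorem no_K5 (p : Fin 5 → ℂ) (c : ∀ i j : Fin 5, i < j → Path (p i) (p j))
    (hd : ∀ i j k l (hij : i < j) (hkl : k < l), i ≠ k → i ≠ l → j ≠ k → j ≠ l →
      Disjoint (Set.range (c i j hij)) (Set.range (c k l hkl))) : False := by
  have hdd : ∀ i j k l (hij : i < j) (hkl : k < l), i ≠ k → i ≠ l → j ≠ k → j ≠ l →
      ∀ s t, (c i j hij).extend s ≠ (c k l hkl).extend t := by
    intro i j k l hij hkl h1 h2 h3 h4 s t h
    have a1 : (c i j hij).extend s ∈ Set.range (c i j hij) := by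
      rw [← Path.extend_range]; exact ⟨s, rfl⟩
    have a2 : (c k l hkl).extend t ∈ Set.range (c k l hkl) := by
      rw [← Path.extend_range]; exact ⟨t, rfl⟩
    rw [h] at a1
    exact Set.disjoint_left.1 (hd i j k l hij hkl h1 h2 h3 h4) a1 a2
  -- a vertex is not on an edge not incident to it
  have hw : ∀ w i j (hij : i < j), w ≠ i → w ≠ j → ∀ s, (c i j hij).extend s ≠ p w := by
    intro w i j hij hi hj s
    obtain ⟨u, hui, huj, huw⟩ : ∃ u : Fin 5, u ≠ i ∧ u ≠ j ∧ u ≠ w := by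
      revert i j w; decide
    rcases lt_or_gt_of_ne huw with h | h
    · have := hdd i j u w hij h hui.symm hi.symm huj.symm hj.symm s 1
      simpa using this
    · have := hdd i j w u hij h hi.symm hui.symm hj.symm huj.symm s 0
      simpa using this
  have hne : ∀ i j, i ≠ j → p i ≠ p j := by
    intro i j hij h
    obtain ⟨u, hui, huj⟩ : ∃ u : Fin 5, u ≠ i ∧ u ≠ j := by clear h; revert i j; decide
    rcases lt_or_gt_of_ne huj with h' | h'
    · have := hw i u j h' hui.symm hij 1
      simp [h] at this
    · have := hw i j u h' hij hui.symm 0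
      simp [h] at this
  let Λ : Fin 5 → Fin 5 → ℂ := fun i j =>
    if i < j then Complex.log (p j - p i) else Complex.log (p i - p j) + Real.pi * Complex.I
  have hΛ : ∀ i j, i ≠ j → Complex.exp (Λ i j) = p j - p i := by
    intro i j hij
    simp only [Λ]
    split_ifs
    · exact Complex.exp_log (sub_ne_zero.2 (hne _ _ hij.symm))
    · rw [Complex.exp_add, Complex.exp_log (sub_ne_zero.2 (hne _ _ hij)), Complex.exp_pi_mul_I]; ring
  have hΛs : ∀ i j, i < j → Λ j i = Λ i j + Real.pi * Complex.I := by
    intro i j hij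
    simp only [Λ, if_pos hij, if_neg hij.le.not_gt]
  have hn : ∀ w i j (hij : i < j), ∃ n : ℤ, w ≠ i → w ≠ j →
      incr (p w) (c i j hij).extend = Λ w j - Λ w i + n * (2 * Real.pi * Complex.I) := by
    intro w i j hij
    by_cases hi : w = i
    · exact ⟨0, fun h => absurd hi h⟩
    by_cases hj : w = j
    · exact ⟨0, fun _ h => absurd hj h⟩
    have h1 := incr_exp (c i j hij).continuous_extend (hw w i j hij hi hj)
    simp only [Path.extend_zero, Path.extend_one] at h1
    rw [← hΛ w i hi, ← hΛ w j hj, ← Complex.exp_add] at h1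
    obtain ⟨n, hn⟩ := Complex.exp_eq_exp_iff_exists_int.1 h1
    exact ⟨n, fun _ _ => by linear_combination hn⟩
  choose n hn using hn
  have hpi : (2 * Real.pi * Complex.I : ℂ) ≠ 0 := Complex.two_pi_I_ne_zero
  -- the square relation
  obtain ⟨ε, hε0, hε1⟩ : ∃ ε : Fin 5 → Fin 5 → ℤ, (∀ a b, a < b → ε a b = 0) ∧
      (∀ a b, b < a → ε a b = 1) :=
    ⟨fun a b => if a < b then 0 else 1, fun a b h => if_pos h, fun a b h => if_neg h.le.not_gt⟩
  have key : ∀ i j k l (hij : i < j) (hkl : k < l), i ≠ k → i ≠ l → j ≠ k → j ≠ l →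
      n k i j hij + n j k l hkl - n i k l hkl - n l i j hij
       - (ε j k + ε k i + ε l j + ε i l) + 2 = 0 := by
    intro i j k l hij hkl h1 h2 h3 h4
    have e := incr_square (c i j hij).continuous_extend (c k l hkl).continuous_extend
      (hdd i j k l hij hkl h1 h2 h3 h4)
    simp only [Path.extend_zero, Path.extend_one] at e
    rw [hn _ _ _ hij h1.symm h3.symm, hn _ _ _ hkl h3 h4, hn _ _ _ hkl h1 h2,
      hn _ _ _ hij h2.symm h4.symm] at e
    have sw : ∀ a b, a ≠ b → Λ b a - Λ a b =
        (((ε a b : ℤ) : ℂ) * (-2) + 1) * (Real.pi * Complex.I) := by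
      intro a b hab
      rcases lt_or_gt_of_ne hab with h | h
      · rw [hΛs a b h, hε0 _ _ h]; push_cast; ring
      · rw [hΛs b a h, hε1 _ _ h]; push_cast; ring
    have s1 := sw j k h3
    have s2 := sw k i h1.symm
    have s3 := sw l j h4.symm
    have s4 := sw i l h2
    have : (((n k i j hij + n j k l hkl - n i k l hkl - n l i j hij
       - (ε j k + ε k i + ε l j + ε i l) + 2 : ℤ)) : ℂ) * (2 * Real.pi * Complex.I) = 0 := by
      push_cast
      linear_combination e - s1 - s2 - s3 - s4
    rcases mul_eq_zero.1 this with h | h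
    · exact_mod_cast h
    · exact absurd h hpi
  have l01 : (0 : Fin 5) < 1 := by decide
  have l02 : (0 : Fin 5) < 2 := by decide
  have l03 : (0 : Fin 5) < 3 := by decide
  have l04 : (0 : Fin 5) < 4 := by decide
  have l12 : (1 : Fin 5) < 2 := by decide
  have l13 : (1 : Fin 5) < 3 := by decide
  have l14 : (1 : Fin 5) < 4 := by decide
  have l23 : (2 : Fin 5) < 3 := by decide
  have l24 : (2 : Fin 5) < 4 := by decide
  have l34 : (3 : Fin 5) < 4 := by decide
  have k1 := key 0 1 2 3 l01 l23 (by decide) (by decide) (by decide) (by decide)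
  have k2 := key 0 1 2 4 l01 l24 (by decide) (by decide) (by decide) (by decide)
  have k3 := key 0 1 3 4 l01 l34 (by decide) (by decide) (by decide) (by decide)
  have k4 := key 0 2 1 3 l02 l13 (by decide) (by decide) (by decide) (by decide)
  have k5 := key 0 2 1 4 l02 l14 (by decide) (by decide) (by decide) (by decide)
  have k6 := key 0 2 3 4 l02 l34 (by decide) (by decide) (by decide) (by decide)
  have k7 := key 0 3 1 2 l03 l12 (by decide) (by decide) (by decide) (by decide)
  have k8 := key 0 3 1 4 l03 l14 (by decide) (by decide) (by decide) (by decide)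
  have k9 := key 0 3 2 4 l03 l24 (by decide) (by decide) (by decide) (by decide)
  have k10 := key 0 4 1 2 l04 l12 (by decide) (by decide) (by decide) (by decide)
  have k11 := key 0 4 1 3 l04 l13 (by decide) (by decide) (by decide) (by decide)
  have k12 := key 0 4 2 3 l04 l23 (by decide) (by decide) (by decide) (by decide)
  have k13 := key 1 2 3 4 l12 l34 (by decide) (by decide) (by decide) (by decide)
  have k14 := key 1 3 2 4 l13 l24 (by decide) (by decide) (by decide) (by decide)
  have k15 := key 1 4 2 3 l14 l23 (by decide) (by decide) (by decide) (by decide)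
  have f01 := hε0 _ _ l01
  have g01 := hε1 _ _ l01
  have f02 := hε0 _ _ l02
  have g02 := hε1 _ _ l02
  have f03 := hε0 _ _ l03
  have g03 := hε1 _ _ l03
  have f04 := hε0 _ _ l04
  have g04 := hε1 _ _ l04
  have f12 := hε0 _ _ l12
  have g12 := hε1 _ _ l12
  have f13 := hε0 _ _ l13
  have g13 := hε1 _ _ l13
  have f14 := hε0 _ _ l14
  have g14 := hε1 _ _ l14
  have f23 := hε0 _ _ l23
  have g23 := hε1 _ _ l23
  have f24 := hε0 _ _ l24
  have g24 := hε1 _ _ l24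
  have f34 := hε0 _ _ l34
  have g34 := hε1 _ _ l34
  clear key hn hΛ hΛs hne hw hdd hd hε0 hε1
  omega


/-- Set version of `no_K5`. -/
theorem no_K5' (p0 p1 p2 p3 p4 : ℂ) (S01 S02 S03 S04 S12 S13 S14 S23 S24 S34 : Set ℂ)
    (h01 : JoinedIn S01 p0 p1)
    (h02 : JoinedIn S02 p0 p2)    (h03 : JoinedIn S03 p0 p3)
    (h04 : JoinedIn S04 p0 p4)    (h12 : JoinedIn S12 p1 p2)
    (h13 : JoinedIn S13 p1 p3)    (h14 : JoinedIn S14 p1 p4)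
    (h23 : JoinedIn S23 p2 p3)
    (h24 : JoinedIn S24 p2 p4)    (h34 : JoinedIn S34 p3 p4)

    (d0123 : Disjoint S01 S23) (d0124 : Disjoint S01 S24) (d0134 : Disjoint S01 S34)
    (d0213 : Disjoint S02 S13) (d0214 : Disjoint S02 S14) (d0234 : Disjoint S02 S34)
    (d0312 : Disjoint S03 S12) (d0314 : Disjoint S03 S14) (d0324 : Disjoint S03 S24)
    (d0412 : Disjoint S04 S12) (d0413 : Disjoint S04 S13) (d0423 : Disjoint S04 S23)
    (d1234 : Disjoint S12 S34) (d1324 : Disjoint S13 S24) (d1423 : Disjoint S14 S23) : False := by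
  let p : Fin 5 → ℂ := ![p0, p1, p2, p3, p4]
  let S : Fin 5 → Fin 5 → Set ℂ := ![![∅, S01, S02, S03, S04], ![∅, ∅, S12, S13, S14],
    ![∅, ∅, ∅, S23, S24], ![∅, ∅, ∅, ∅, S34], ![∅, ∅, ∅, ∅, ∅]]
  have hS : ∀ i j, i < j → JoinedIn (S i j) (p i) (p j) := by
    intro i j h
    fin_cases i <;> fin_cases j <;> first
      | exact absurd h (by decide)
      | assumption
  have hD : ∀ i j k l : Fin 5, i < j → k < l → i < k → i ≠ l → j ≠ k → j ≠ l →
      Disjoint (S i j) (S k l) := by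
    intro i j k l h1 h2 h3 h4 h5 h6
    fin_cases i <;> fin_cases j <;> first
      | exact absurd h1 (by decide)
      | (fin_cases k <;> first
          | exact absurd h3 (by decide)
          | (fin_cases l <;> first
              | exact absurd h2 (by decide)
              | assumption
              | exact absurd rfl h4
              | exact absurd rfl h5
              | exact absurd rfl h6))
  refine no_K5 p (fun i j h => (hS i j h).somePath) ?_
  intro i j k l hij hkl h1 h2 h3 h4
  have r1 : Set.range (hS i j hij).somePath ⊆ S i j := by
    rintro _ ⟨t, rfl⟩; exact (hS i j hij).somePath_mem t
  have r2 : Set.range (hS k l hkl).somePath ⊆ S k l := by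
    rintro _ ⟨t, rfl⟩; exact (hS k l hkl).somePath_mem t
  refine Disjoint.mono r1 r2 ?_
  rcases lt_or_gt_of_ne h1 with h | h
  · exact hD i j k l hij hkl h h2 h3 h4
  · exact (hD k l i j hkl hij h h3.symm h2.symm h4.symm).symm


lemma joinedIn_arc (O : ℂ) (r a b : ℝ) (F : Set ℂ)
    (hF : ∀ φ : ℝ, (a ≤ φ ∧ φ ≤ b) ∨ (b ≤ φ ∧ φ ≤ a) → O + r * Complex.exp (φ * Complex.I) ∈ F) :
    JoinedIn F (O + r * Complex.exp (a * Complex.I)) (O + r * Complex.exp (b * Complex.I)) := by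
  refine ⟨⟨⟨fun s => O + r * Complex.exp ((((1 - s) * a + s * b : ℝ) : ℂ) * Complex.I),
    by fun_prop⟩, by simp, by simp⟩, ?_⟩
  intro s
  apply hF
  have h0 := s.2.1
  have h1 := s.2.2
  rcases le_total a b with h | h
  · left; constructor <;> nlinarith
  · right; constructor <;> nlinarith

lemma joinedIn_radius (O : ℂ) (r a : ℝ) (F : Set ℂ)
    (hF : ∀ s : ℝ, 0 ≤ s → s ≤ 1 → O + (s * r) * Complex.exp (a * Complex.I) ∈ F) :
    JoinedIn F O (O + r * Complex.exp (a * Complex.I)) := by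
  refine ⟨⟨⟨fun s => O + (s * r) * Complex.exp (a * Complex.I),
    by fun_prop⟩, by simp, by simp⟩, ?_⟩
  intro s
  exact hF s s.2.1 s.2.2

lemma polar_unique (O : ℂ) (r : ℝ) (hr : 0 < r) (s a b : ℝ) (hs : 0 ≤ s)
    (h : O + (s * r) * Complex.exp (a * Complex.I) = O + r * Complex.exp (b * Complex.I)) :
    ∃ n : ℤ, a = b + n * (2 * Real.pi) := by
  have h' := add_left_cancel h
  have hn := congrArg norm h'
  simp only [norm_mul, Complex.norm_exp_ofReal_mul_I, Complex.norm_real, Real.norm_eq_abs,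
    mul_one, abs_of_pos hr, abs_of_nonneg hs] at hn
  have hs1 : s = 1 := by nlinarith
  subst hs1
  have hr' : (r : ℂ) ≠ 0 := by exact_mod_cast hr.ne'
  simp only [Complex.ofReal_one, one_mul] at h'
  have h2 := mul_left_cancel₀ hr' h'
  obtain ⟨n, hn⟩ := Complex.exp_eq_exp_iff_exists_int.1 h2
  refine ⟨n, ?_⟩
  have h3 : ((a : ℂ)) = b + n * (2 * Real.pi) := by
    have := Complex.I_ne_zero
    apply mul_right_cancel₀ this
    linear_combination hn
  exact_mod_cast h3

lemma no_int_between {a b : ℝ} (n : ℤ) (h1 : a < b) (h2 : b < a + 2 * Real.pi)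
    (h : a = b + n * (2 * Real.pi)) : False := by
  have hp := Real.pi_pos
  have h3 : (n : ℝ) < 0 := by by_contra hh; push Not at hh; nlinarith
  have h4 : (-1 : ℝ) < n := by by_contra hh; push Not at hh; nlinarith
  have h5 : n < 0 := by exact_mod_cast h3
  have h6 : -1 < n := by exact_mod_cast h4
  omega

/-- Two sets joining crossing pairs of points of a circle outside of it must meet. -/
theorem no_cross (O : ℂ) (r : ℝ) (hr : 0 < r) (a b c d : ℝ) (hab : a < b) (hbc : b < c)
    (hcd : c < d) (hda : d < a + 2 * Real.pi) (P Q : Set ℂ)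
    (hP : JoinedIn P (O + r * Complex.exp (a * Complex.I)) (O + r * Complex.exp (c * Complex.I)))
    (hQ : JoinedIn Q (O + r * Complex.exp (b * Complex.I)) (O + r * Complex.exp (d * Complex.I)))
    (hPQ : Disjoint P Q)
    (hP' : ∀ z ∈ P, ‖z - O‖ ≤ r → z = O + r * Complex.exp (a * Complex.I) ∨
      z = O + r * Complex.exp (c * Complex.I))
    (hQ' : ∀ z ∈ Q, ‖z - O‖ ≤ r → z = O + r * Complex.exp (b * Complex.I) ∨
      z = O + r * Complex.exp (d * Complex.I)) : False := by
  have hp := Real.pi_pos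
  let R : ℝ → Set ℂ := fun θ => {z | ∃ s : ℝ, 0 ≤ s ∧ s ≤ 1 ∧
    z = O + (s * r) * Complex.exp (θ * Complex.I)}
  let A : ℝ → ℝ → Set ℂ := fun u w => {z | ∃ φ : ℝ, u ≤ φ ∧ φ ≤ w ∧
    z = O + r * Complex.exp (φ * Complex.I)}
  have hR : ∀ θ, JoinedIn (R θ) O (O + r * Complex.exp (θ * Complex.I)) := fun θ =>
    joinedIn_radius O r θ _ (fun s h0 h1 => ⟨s, h0, h1, rfl⟩)
  have hA : ∀ u w, u ≤ w → JoinedIn (A u w) (O + r * Complex.exp (u * Complex.I))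
      (O + r * Complex.exp (w * Complex.I)) := fun u w huw =>
    joinedIn_arc O r u w _ (by
      rintro φ (h | h)
      · exact ⟨φ, h.1, h.2, rfl⟩
      · exact ⟨φ, by linarith, by linarith, rfl⟩)
  have per : O + r * Complex.exp ((d - 2 * Real.pi : ℝ) * Complex.I) =
      O + r * Complex.exp (d * Complex.I) := by
    congr 2
    rw [Complex.exp_eq_exp_iff_exists_int]
    exact ⟨-1, by push_cast; ring⟩
  have hAR : ∀ u w θ, (w < θ ∧ θ < u + 2 * Real.pi) ∨ (θ < u ∧ w < θ + 2 * Real.pi) →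
      Disjoint (R θ) (A u w) := by
    intro u w θ h12
    rw [Set.disjoint_left]
    rintro z ⟨s, h0, _, rfl⟩ ⟨φ, hφ1, hφ2, h⟩
    obtain ⟨n, hn⟩ := polar_unique O r hr s θ φ h0 h
    rcases h12 with ⟨h1, h2⟩ | ⟨h1, h2⟩
    · exact no_int_between (a := φ) (b := θ) (-n) (by linarith) (by linarith)
        (by push_cast; linarith)
    · exact no_int_between n (by linarith) (by linarith) hn
  have hAA : ∀ u w u' w', w < u' → w' < u + 2 * Real.pi → Disjoint (A u w) (A u' w') := by
    intro u w u' w' h1 h2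
    rw [Set.disjoint_left]
    rintro z ⟨θ, hθ1, hθ2, rfl⟩ ⟨φ, hφ1, hφ2, h⟩
    obtain ⟨n, hn⟩ := polar_unique O r hr 1 θ φ zero_le_one (by simpa using h)
    exact no_int_between n (by linarith) (by linarith) hn
  have hRX : ∀ (X : Set ℂ) (u w θ : ℝ), (∀ z ∈ X, ‖z - O‖ ≤ r →
      z = O + r * Complex.exp (u * Complex.I) ∨ z = O + r * Complex.exp (w * Complex.I)) →
      (∀ n : ℤ, θ ≠ u + n * (2 * Real.pi)) → (∀ n : ℤ, θ ≠ w + n * (2 * Real.pi)) →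
      Disjoint (R θ) X := by
    intro X u w θ hX hu hw
    rw [Set.disjoint_left]
    rintro z ⟨s, h0, h1, rfl⟩ hz
    rcases hX _ hz (by
      simp only [add_sub_cancel_left, norm_mul, Complex.norm_exp_ofReal_mul_I, Complex.norm_real,
        Real.norm_eq_abs, mul_one, abs_of_pos hr, abs_of_nonneg h0]
      nlinarith) with h | h
    · obtain ⟨n, hn⟩ := polar_unique O r hr s θ u h0 h
      exact hu n hn
    · obtain ⟨n, hn⟩ := polar_unique O r hr s θ w h0 h
      exact hw n hn
  have ne1 : ∀ u w : ℝ, u < w → w < u + 2 * Real.pi → ∀ n : ℤ, u ≠ w + n * (2 * Real.pi) :=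
    fun u w h1 h2 n h => no_int_between n h1 h2 h
  have ne2 : ∀ u w : ℝ, u < w → w < u + 2 * Real.pi → ∀ n : ℤ, w ≠ u + n * (2 * Real.pi) :=
    fun u w h1 h2 n h => no_int_between (-n) h1 h2 (by push_cast; linarith)
  refine no_K5' O (O + r * Complex.exp (a * Complex.I)) (O + r * Complex.exp (b * Complex.I))
    (O + r * Complex.exp (c * Complex.I)) (O + r * Complex.exp (d * Complex.I))
    (R a) (R b) (R c) (R d) (A a b) P (A (d - 2 * Real.pi) a) (A b c) Q (A c d)
    (hR a) (hR b) (hR c) (hR d) (hA a b hab.le) hP (by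
      have := hA (d - 2 * Real.pi) a (by linarith)
      rw [per] at this
      exact this.symm) (hA b c hbc.le) hQ (hA c d hcd.le)
    ?_ ?_ ?_ ?_ ?_ ?_ ?_ ?_ ?_ ?_ ?_ ?_ ?_ ?_ ?_
  · exact hAR _ _ _ (Or.inr ⟨(by linarith), (by linarith)⟩)
  · exact hRX Q b d a hQ' (ne1 _ _ (by linarith) (by linarith)) (ne1 _ _ (by linarith) (by linarith))
  · exact hAR _ _ _ (Or.inr ⟨(by linarith), (by linarith)⟩)
  · exact hRX P a c b hP' (ne2 _ _ (by linarith) (by linarith)) (ne1 _ _ (by linarith) (by linarith))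
  · exact hAR _ _ _ (Or.inl ⟨(by linarith), (by linarith)⟩)
  · exact hAR _ _ _ (Or.inr ⟨(by linarith), (by linarith)⟩)
  · exact hAR _ _ _ (Or.inl ⟨(by linarith), (by linarith)⟩)
  · exact hAR _ _ _ (Or.inl ⟨(by linarith), (by linarith)⟩)
  · exact hRX Q b d c hQ' (ne2 _ _ (by linarith) (by linarith)) (ne1 _ _ (by linarith) (by linarith))
  · exact hAR _ _ _ (Or.inl ⟨(by linarith), (by linarith)⟩)
  · exact hRX P a c d hP' (ne2 _ _ (by linarith) (by linarith)) (ne2 _ _ (by linarith) (by linarith))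
  · exact hAR _ _ _ (Or.inl ⟨(by linarith), (by linarith)⟩)
  · exact hAA _ _ _ _ (by linarith) (by linarith)
  · exact hPQ
  · exact hAA _ _ _ _ (by linarith) (by linarith)


/-- The part of a curve after its last visit of a disc. -/
lemma exists_tail {O p q : ℂ} (γ : Path p q) (r : ℝ) (h0 : ‖p - O‖ ≤ r) (h1 : r < ‖q - O‖) :
    ∃ (S : Set ℂ) (m : ℂ), S ⊆ Set.range γ ∧ JoinedIn S m q ∧ ‖m - O‖ = r ∧
      ∀ z ∈ S, ‖z - O‖ ≤ r → z = m := by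
  have hc : Continuous fun s : ℝ => ‖γ.extend s - O‖ := by
    have := γ.continuous_extend
    fun_prop
  have hK : IsCompact {s : ℝ | s ∈ Set.Icc (0 : ℝ) 1 ∧ ‖γ.extend s - O‖ ≤ r} :=
    isCompact_Icc.inter_right (isClosed_le hc continuous_const)
  obtain ⟨τ, ⟨hτI, hτr⟩, hτ⟩ := hK.exists_isGreatest ⟨0, by simp, by simpa using h0⟩
  obtain ⟨s, hs, hsr⟩ := intermediate_value_Icc hτI.2 hc.continuousOn
    (show r ∈ Set.Icc _ _ from ⟨hτr, by simpa using h1.le⟩)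
  have hs' : s ≤ τ := hτ ⟨⟨hτI.1.trans hs.1, hs.2⟩, hsr.le⟩
  have hst : s = τ := le_antisymm hs' hs.1
  subst hst
  refine ⟨γ.extend '' Set.Icc s 1, γ.extend s, ?_, ?_, hsr, ?_⟩
  · rintro _ ⟨u, -, rfl⟩
    rw [← Path.extend_range]; exact ⟨u, rfl⟩
  · refine ⟨⟨⟨fun u => γ.extend ((1 - u) * s + u), ?_⟩, by simp, by simp⟩, ?_⟩
    · have := γ.continuous_extend
      fun_prop
    · intro u
      refine ⟨_, ⟨?_, ?_⟩, rfl⟩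
      · have := u.2.1; have := u.2.2; have := hτI.2; nlinarith
      · have := u.2.1; have := u.2.2; have := hτI.2; nlinarith
  · rintro _ ⟨u, hu, rfl⟩ hle
    have : u ≤ s := hτ ⟨⟨hτI.1.trans hu.1, hu.2⟩, hle⟩
    rw [le_antisymm this hu.1]

/-- A combinatorial form of planarity in `ℂ`: vertices are points, edges are sets. -/
lemma planar_sets (G : SimpleGraph V) (hplanar : IsPlanar G) :
    ∃ (F : V → ℂ) (E : V → V → Set ℂ), Function.Injective F ∧
      (∀ u w, G.Adj u w → ∃ γ : Path (F u) (F w), E u w = Set.range γ) ∧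
      (∀ u, E u u = {F u}) ∧
      (∀ u w u' w', (G.Adj u w ∨ u = w) → (G.Adj u' w' ∨ u' = w') →
        u ≠ u' → u ≠ w' → w ≠ u' → w ≠ w' → Disjoint (E u w) (E u' w')) ∧
      (∀ x u u', G.Adj x u → G.Adj x u' → u ≠ u' → E x u ∩ E x u' ⊆ {F x}) := by
  classical
  obtain ⟨f, e, hf, hcont, -, hend, hoff, hmeet⟩ := hplanar
  let κ := Complex.equivRealProdCLM.symm
  have hκ : Function.Injective κ := κ.injective
  let E : V → V → Set ℂ := fun u w => if h : G.Adj u w then κ '' Set.range (e u w h) else {κ (f u)}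
  have hE : ∀ u w (h : G.Adj u w), E u w = κ '' Set.range (e u w h) := fun u w h => dif_pos h
  have hE' : ∀ u, E u u = {κ (f u)} := fun u => dif_neg (G.irrefl)
  have hpt : ∀ z u w, G.Adj u w → z ≠ u → z ≠ w → κ (f z) ∉ E u w := by
    intro z u w h h1 h2 hz
    rw [hE u w h] at hz
    obtain ⟨y, hy, hyz⟩ := hz
    rw [hκ hyz] at hy
    exact hoff u w h z h1 h2 hy
  refine ⟨fun u => κ (f u), E, hκ.comp hf, ?_, hE', ?_, ?_⟩
  · intro u w h
    refine ⟨⟨⟨fun s => κ (e u w h s), κ.continuous.comp (hcont u w h)⟩, ?_, ?_⟩, ?_⟩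
    · exact congrArg κ (hend u w h).1
    · exact congrArg κ (hend u w h).2
    · rw [hE u w h, ← Set.range_comp]; rfl
  · rintro u w u' w' (h | rfl) (h' | rfl) h1 h2 h3 h4
    · rw [hE u w h, hE u' w' h', Set.disjoint_image_iff hκ, Set.disjoint_left]
      intro y hy hy'
      have hne : ({u, w} : Set V) ≠ {u', w'} := by
        intro hh
        have : u ∈ ({u', w'} : Set V) := hh ▸ (by simp)
        simp [h1, h2] at this
      obtain ⟨⟨p, hp, hpy⟩, ⟨p', hp', hpy'⟩⟩ := hmeet u w h u' w' h' hne ⟨hy, hy'⟩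
      have : p = p' := hf (hpy.trans hpy'.symm)
      subst this
      simp only [Set.mem_insert_iff, Set.mem_singleton_iff] at hp hp'
      rcases hp with rfl | rfl <;> rcases hp' with h | h <;> contradiction
    · rw [hE' u', Set.disjoint_singleton_right]
      exact hpt u' u w h h1.symm h3.symm
    · rw [hE' u, Set.disjoint_singleton_left]
      exact hpt u u' w' h' h1 h2
    · rw [hE' u, hE' u', Set.disjoint_singleton_left, Set.mem_singleton_iff]
      exact fun hh => h1 (hf (hκ hh))
  · intro x u u' h h' hne z hz
    rw [hE x u h, hE x u' h'] at hz
    obtain ⟨⟨y, hy, rfl⟩, ⟨y', hy', hyy⟩⟩ := hz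
    rw [hκ hyy] at hy'
    have hne' : ({x, u} : Set V) ≠ {x, u'} := by
      intro hh
      have : u ∈ ({x, u'} : Set V) := hh ▸ (by simp)
      simp [hne, h.ne'] at this
    obtain ⟨⟨p, hp, hpy⟩, ⟨p', hp', hpy'⟩⟩ := hmeet x u h x u' h' hne' ⟨hy, hy'⟩
    have : p = p' := hf (hpy.trans hpy'.symm)
    subst this
    simp only [Set.mem_insert_iff, Set.mem_singleton_iff] at hp hp'
    rcases hp with rfl | rfl
    · simp [hpy]
    · rcases hp' with rfl | h
      · simp [hpy]
      · contradiction

/-- Noncrossing condition for an enumeration of the neighbors of `x`. -/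
def NonCrossing (G : SimpleGraph V) (x : V) (t : ℤ) (v : ℤ → V) : Prop :=
  ∀ a b c d : ℤ, a < b → b < c → c < d → d < a + t → ∀ z w : V, z ≠ x → w ≠ x →
    (z = v a ∨ G.Adj (v a) z) → G.Adj z (v c) → (w = v b ∨ G.Adj (v b) w) → G.Adj w (v d) →
    z ≠ w → z ≠ v b → z ≠ v d → w ≠ v a → w ≠ v c → False

/-- Enumeration by increasing angle. -/
lemma exists_angle_enum (S : Finset V) (t : ℕ) (ht : S.card = t) (ht0 : 0 < t) (ang : V → ℝ)
    (hinj : ∀ u ∈ S, ∀ w ∈ S, ang u = ang w → u = w) (h1 : ∀ u, -Real.pi < ang u)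
    (h2 : ∀ u, ang u ≤ Real.pi) :
    ∃ (v : ℤ → V) (θ : ℤ → ℝ), StrictMono θ ∧ (∀ i, θ (i + t) = θ i + 2 * Real.pi) ∧
      (∀ i, ∃ n : ℤ, θ i = ang (v i) + n * (2 * Real.pi)) ∧ (∀ i, v i ∈ S) ∧
      (∀ i, v (i + t) = v i) ∧ (∀ u ∈ S, ∃ i : ℤ, v i = u) ∧
      (∀ i j, v i = v j → (t : ℤ) ∣ i - j) := by
  classical
  have hc : (S.image ang).card = t := by
    rw [Finset.card_image_of_injOn, ht]
    intro u hu w hw h; exact hinj u hu w hw h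
  let emb := (S.image ang).orderEmbOfFin hc
  have hemb : ∀ k, ∃ u ∈ S, ang u = emb k := by
    intro k
    have := Finset.orderEmbOfFin_mem (S.image ang) hc k
    exact Finset.mem_image.1 this
  choose u hu hau using hemb
  have htz : (0 : ℤ) < t := by exact_mod_cast ht0
  let idx : ℤ → Fin t := fun i => ⟨(i % t).toNat, by
    have := Int.emod_nonneg i htz.ne'
    have := Int.emod_lt_of_pos i htz
    omega⟩
  have hidx : ∀ i, ((idx i : ℕ) : ℤ) = i % t := fun i =>
    Int.toNat_of_nonneg (Int.emod_nonneg i htz.ne')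
  have hidxt : ∀ i, idx (i + t) = idx i := by
    intro i; apply Fin.ext; zify; rw [hidx, hidx]; simp
  have hp := Real.pi_pos
  refine ⟨fun i => u (idx i), fun i => ang (u (idx i)) + ((i / t : ℤ) : ℝ) * (2 * Real.pi),
    ?_, ?_, fun i => ⟨_, rfl⟩, fun i => hu _, ?_, ?_, ?_⟩
  · intro i j hij
    have hd : i / t ≤ j / t := Int.ediv_le_ediv htz hij.le
    rcases hd.eq_or_lt with h | h
    · simp only [h, hau]
      have : idx i < idx j := by
        rw [Fin.lt_def]; zify; rw [hidx, hidx]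
        have e1 := Int.mul_ediv_add_emod i t
        have e2 := Int.mul_ediv_add_emod j t
        rw [h] at e1
        omega
      have := emb.strictMono this
      linarith
    · have h' : ((i / t : ℤ) : ℝ) + 1 ≤ ((j / t : ℤ) : ℝ) := by exact_mod_cast h
      have := h1 (u (idx j))
      have := h2 (u (idx i))
      simp only
      nlinarith
  · intro i
    simp only [hidxt]
    rw [Int.add_ediv_of_dvd_right (dvd_refl _), Int.ediv_self htz.ne']
    push_cast; ring
  · intro i; simp only [hidxt]
  · intro w hw
    have : ang w ∈ Set.range emb := by
      rw [Finset.range_orderEmbOfFin]; simp; exact ⟨w, hw, rfl⟩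
    obtain ⟨k, hk⟩ := this
    refine ⟨(k : ℕ), ?_⟩
    have : idx ((k : ℕ) : ℤ) = k := by
      apply Fin.ext; zify; rw [hidx]
      exact Int.emod_eq_of_lt (by positivity) (by exact_mod_cast k.2)
    simp only [this]
    exact hinj _ (hu _) _ hw (by rw [hau, hk])
  · intro i j hij
    have h : emb (idx i) = emb (idx j) := by rw [← hau, ← hau]; exact congrArg ang hij
    have h' : idx i = idx j := emb.injective h
    have h'' : i % t = j % t := by rw [← hidx, ← hidx, h']
    exact Int.ModEq.dvd (h''.symm)



theorem exists_cyclic_order (G : SimpleGraph V) [G.LocallyFinite] (hplanar : IsPlanar G) (x : V)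
    (t : ℕ) (ht : G.degree x = t) (ht0 : 0 < t) :
    ∃ v : ℤ → V, (∀ i, G.Adj x (v i)) ∧ (∀ i, v (i + t) = v i) ∧
      (∀ u, G.Adj x u → ∃ i : ℤ, v i = u) ∧ (∀ i j, v i = v j → (t : ℤ) ∣ i - j) ∧
      NonCrossing G x t v := by
  classical
  obtain ⟨F, E, hF, hpath, hEu, hdis, hmeet⟩ := planar_sets G hplanar
  have hjoin : ∀ u w, (G.Adj u w ∨ u = w) → JoinedIn (E u w) (F u) (F w) := by
    rintro u w (h | rfl)
    · obtain ⟨γ, hγ⟩ := hpath u w h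
      exact ⟨γ, fun s => hγ ▸ ⟨s, rfl⟩⟩
    · exact JoinedIn.refl (by simp [hEu])
  have hcomp : ∀ u w, (G.Adj u w ∨ u = w) → IsCompact (E u w) := by
    rintro u w (h | rfl)
    · obtain ⟨γ, hγ⟩ := hpath u w h
      rw [hγ]; exact isCompact_range γ.continuous
    · rw [hEu]; exact isCompact_singleton
  -- a small disc around `x`
  let I : Finset (V × V) := (G.neighborFinset x).biUnion fun u =>
    (insert (u, u) (((G.neighborFinset u).erase x).image fun w => (u, w))) ∪
      ((G.neighborFinset u).erase x).image fun w => (w, u)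
  have hI : ∀ p ∈ I, (G.Adj p.1 p.2 ∨ p.1 = p.2) ∧ p.1 ≠ x ∧ p.2 ≠ x := by
    intro p hp
    simp only [I, Finset.mem_biUnion, SimpleGraph.mem_neighborFinset, Finset.mem_union,
      Finset.mem_insert, Finset.mem_image, Finset.mem_erase] at hp
    obtain ⟨u, hu, (rfl | ⟨w, ⟨hw, hw'⟩, rfl⟩) | ⟨w, ⟨hw, hw'⟩, rfl⟩⟩ := hp
    · exact ⟨Or.inr rfl, hu.ne', hu.ne'⟩
    · exact ⟨Or.inl hw', hu.ne', hw⟩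
    · exact ⟨Or.inl hw'.symm, hw, hu.ne'⟩
  have hK : IsCompact (⋃ p ∈ I, E p.1 p.2) :=
    I.finite_toSet.isCompact_biUnion fun p hp => hcomp _ _ (hI p hp).1
  have hxK : F x ∈ (⋃ p ∈ I, E p.1 p.2)ᶜ := by
    simp only [Set.mem_compl_iff, Set.mem_iUnion, not_exists]
    intro p hp hx
    obtain ⟨h1, h2, h3⟩ := hI p hp
    have := hdis p.1 p.2 x x h1 (Or.inr rfl) h2 h2 h3 h3
    rw [hEu] at this
    exact Set.disjoint_left.1 this hx rfl
  obtain ⟨r0, hr0, hball⟩ := Metric.isOpen_iff.1 hK.isClosed.isOpen_compl _ hxK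
  obtain ⟨r, hr, hrr⟩ : ∃ r, 0 < r ∧ r < r0 := ⟨r0 / 2, by linarith, by linarith⟩
  have hfar : ∀ p ∈ I, ∀ y ∈ E p.1 p.2, r < ‖y - F x‖ := by
    intro p hp y hy
    by_contra hh
    push Not at hh
    have : y ∈ Metric.ball (F x) r0 := by rw [mem_ball_iff_norm]; linarith
    exact hball this (Set.mem_biUnion hp hy)
  have hI1 : ∀ u, G.Adj x u → (u, u) ∈ I := by
    intro u hu
    simp only [I, Finset.mem_biUnion, SimpleGraph.mem_neighborFinset]
    exact ⟨u, hu, by simp⟩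
  have hI2 : ∀ u w, G.Adj x u → (w = u ∨ G.Adj u w) → w ≠ x → (u, w) ∈ I := by
    rintro u w hu (rfl | hw) hwx
    · exact hI1 _ hu
    simp only [I, Finset.mem_biUnion, SimpleGraph.mem_neighborFinset]
    refine ⟨u, hu, ?_⟩
    simp [hw, hwx]
  have hI3 : ∀ u w, G.Adj x u → G.Adj w u → w ≠ x → (w, u) ∈ I := by
    intro u w hu hw hwx
    simp only [I, Finset.mem_biUnion, SimpleGraph.mem_neighborFinset]
    refine ⟨u, hu, ?_⟩
    simp [hw.symm, hwx]
  -- tails of the edges at `x`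
  have htail : ∀ u, ∃ (S : Set ℂ) (m : ℂ), G.Adj x u → S ⊆ E x u ∧ JoinedIn S m (F u) ∧
      ‖m - F x‖ = r ∧ ∀ z ∈ S, ‖z - F x‖ ≤ r → z = m := by
    intro u
    by_cases hu : G.Adj x u
    · obtain ⟨γ, hγ⟩ := hpath x u hu
      obtain ⟨S, m, h1, h2, h3, h4⟩ := exists_tail (O := F x) γ r (by simpa using hr.le)
        (hfar _ (hI1 u hu) (F u) (by simp [hEu]))
      exact ⟨S, m, fun _ => ⟨hγ ▸ h1, h2, h3, h4⟩⟩
    · exact ⟨∅, 0, fun h => absurd h hu⟩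
  choose T m htail using htail
  have hmT : ∀ u, G.Adj x u → m u ∈ T u := fun u hu => (htail u hu).2.1.source_mem
  have hxT : ∀ u, G.Adj x u → F x ∉ T u := by
    intro u hu hx
    have h1 := (htail u hu).2.2.2 _ hx (by simpa using hr.le)
    have h2 := (htail u hu).2.2.1
    rw [← h1] at h2
    simp at h2
    exact hr.ne h2
  have hTT : ∀ u w, G.Adj x u → G.Adj x w → u ≠ w → Disjoint (T u) (T w) := by
    intro u w hu hw huw
    rw [Set.disjoint_left]
    intro y h1 h2
    have := hmeet x u w hu hw huw ⟨(htail u hu).1 h1, (htail w hw).1 h2⟩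
    rw [Set.mem_singleton_iff] at this
    rw [this] at h1
    exact hxT u hu h1
  have hTE : ∀ u p q, G.Adj x u → (G.Adj p q ∨ p = q) → p ≠ x → q ≠ x → u ≠ p → u ≠ q →
      Disjoint (T u) (E p q) := by
    intro u p q hu hpq h1 h2 h3 h4
    exact (hdis x u p q (Or.inl hu) hpq h1.symm h2.symm h3 h4).mono_left (htail u hu).1
  -- angles
  let ang : V → ℝ := fun u => Complex.arg (m u - F x)
  have hang : ∀ u, G.Adj x u → m u = F x + r * Complex.exp (ang u * Complex.I) := by
    intro u hu
    have := Complex.norm_mul_exp_arg_mul_I (m u - F x)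
    rw [(htail u hu).2.2.1] at this
    rw [this]; ring
  obtain ⟨v, θ, hθm, hθt, hθv, hvS, hvt, hvs, hvi⟩ := exists_angle_enum (G.neighborFinset x) t
    (by simpa using ht) ht0 ang (by
      intro u hu w hw h
      rw [SimpleGraph.mem_neighborFinset] at hu hw
      by_contra hne
      have h1 : m u = m w := by rw [hang u hu, hang w hw, h]
      exact Set.disjoint_left.1 (hTT u w hu hw hne) (hmT u hu) (h1 ▸ hmT w hw))
    (fun u => Complex.neg_pi_lt_arg _) (fun u => Complex.arg_le_pi _)
  have hadj : ∀ i, G.Adj x (v i) := fun i => by simpa using hvS i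
  refine ⟨v, hadj, hvt, fun u hu => hvs u (by simpa using hu), hvi, ?_⟩
  have hm : ∀ i, m (v i) = F x + r * Complex.exp (θ i * Complex.I) := by
    intro i
    rw [hang _ (hadj i)]
    obtain ⟨n, hn⟩ := hθv i
    congr 2
    rw [Complex.exp_eq_exp_iff_exists_int]
    exact ⟨-n, by rw [hn]; push_cast; ring⟩
  have hvne : ∀ i j : ℤ, i < j → j < i + t → v i ≠ v j := by
    intro i j h1 h2 h
    obtain ⟨k, hk⟩ := hvi j i h.symm
    have h3 : 0 < (t : ℤ) * k := by omega
    have h4 : (t : ℤ) * k < t * 1 := by omega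
    have h5 : 0 < k := by
      by_contra hh
      push Not at hh
      have : (t : ℤ) * k ≤ 0 := mul_nonpos_of_nonneg_of_nonpos (by positivity) hh
      omega
    have h6 : k < 1 := lt_of_mul_lt_mul_left h4 (by positivity)
    omega
  -- the curves
  have hcurve : ∀ a c z, z ≠ x → (z = v a ∨ G.Adj (v a) z) → G.Adj z (v c) →
      JoinedIn (T (v a) ∪ E (v a) z ∪ E z (v c) ∪ T (v c)) (m (v a)) (m (v c)) ∧
      ∀ y ∈ (T (v a) ∪ E (v a) z ∪ E z (v c) ∪ T (v c)), ‖y - F x‖ ≤ r →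
        y = m (v a) ∨ y = m (v c) := by
    intro a c z hz h1 h2
    constructor
    · have j1 := (htail _ (hadj a)).2.1
      have j2 := hjoin (v a) z (h1.symm.imp id Eq.symm)
      have j3 := hjoin z (v c) (Or.inl h2)
      have j4 := (htail _ (hadj c)).2.1.symm
      refine (((j1.mono ?_).trans (j2.mono ?_)).trans (j3.mono ?_)).trans (j4.mono ?_) <;>
        intro y hy <;> simp [hy]
    · rintro y (((hy | hy) | hy) | hy) hle
      · exact Or.inl ((htail _ (hadj a)).2.2.2 y hy hle)
      · have := hfar _ (hI2 (v a) z (hadj a) h1 hz) y hy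
        linarith
      · have := hfar _ (hI3 (v c) z (hadj c) h2 hz) y hy
        linarith
      · exact Or.inr ((htail _ (hadj c)).2.2.2 y hy hle)
  intro a b c d hab hbc hcd hda z w hz hw h1 h2 h3 h4 n1 n2 n3 n4 n5
  obtain ⟨jP, fP⟩ := hcurve a c z hz h1 h2
  obtain ⟨jQ, fQ⟩ := hcurve b d w hw h3 h4
  have nab := hvne a b hab (by omega)
  have nbc := hvne b c hbc (by omega)
  have ncd := hvne c d hcd (by omega)
  have nad := hvne a d (by omega) (by omega)
  have xa := (hadj a).ne'
  have xb := (hadj b).ne'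
  have xc := (hadj c).ne'
  have xd := (hadj d).ne'
  have o1 : G.Adj (v a) z ∨ v a = z := h1.symm.imp id Eq.symm
  have o2 : G.Adj z (v c) ∨ z = v c := Or.inl h2
  have o3 : G.Adj (v b) w ∨ v b = w := h3.symm.imp id Eq.symm
  have o4 : G.Adj w (v d) ∨ w = v d := Or.inl h4
  rw [hm, hm] at jP jQ
  simp only [hm] at fP fQ
  refine no_cross (F x) r hr (θ a) (θ b) (θ c) (θ d) (hθm hab) (hθm hbc) (hθm hcd)
    (by rw [← hθt]; exact hθm hda) _ _ jP jQ ?_ fP fQ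
  simp only [Set.disjoint_union_left, Set.disjoint_union_right]
  repeat' apply And.intro
  all_goals first
    | (apply hTT <;> first | exact hadj _ | assumption | (apply Ne.symm; assumption))
    | (apply hdis <;> first | assumption | (apply Ne.symm; assumption))
    | (apply hTE <;> first | exact hadj _ | assumption | (apply Ne.symm; assumption))
    | (apply Disjoint.symm; apply hTE <;>
        first | exact hadj _ | assumption | (apply Ne.symm; assumption))


lemma lip_dist (G : SimpleGraph V) (hconn : G.Connected) (f : V → ℝ)
    (hf : ∀ p q, G.Adj p q → f q - f p ≤ 1) (p q : V) : f q - f p ≤ (G.dist p q : ℝ) := by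
  obtain ⟨w, hw⟩ := hconn.exists_walk_length_eq_dist p q
  rw [← hw]
  clear hw
  induction w with
  | nil => simp
  | cons h w ih =>
    have := hf _ _ h
    rw [SimpleGraph.Walk.length_cons]
    push_cast
    linarith

lemma lazyWalk_sum (G : SimpleGraph V) [G.LocallyFinite] (α : ℝ) (x : V) (g : V → ℝ)
    (S : Finset V) (hx : x ∈ S) (hS : ∀ u, G.Adj x u → u ∈ S) :
    ∑ p ∈ S, g p * lazyWalk G α x p =
      α * g x + (1 - α) / (G.degree x : ℝ) * ∑ p ∈ G.neighborFinset x, g p := by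
  classical
  have hsub : insert x (G.neighborFinset x) ⊆ S := by
    intro u hu
    rw [Finset.mem_insert, SimpleGraph.mem_neighborFinset] at hu
    rcases hu with rfl | hu
    · exact hx
    · exact hS u hu
  rw [← Finset.sum_subset hsub, Finset.sum_insert (by simp), Finset.mul_sum]
  · congr 1
    · simp [lazyWalk]; ring
    · apply Finset.sum_congr rfl
      intro u hu
      rw [SimpleGraph.mem_neighborFinset] at hu
      simp [lazyWalk, hu, hu.ne']; ring
  · intro u _ hu
    rw [Finset.mem_insert, SimpleGraph.mem_neighborFinset, not_or] at hu
    simp [lazyWalk, hu.1, hu.2]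

lemma lazyWalk_eq_zero (G : SimpleGraph V) [G.LocallyFinite] (α : ℝ) (x u : V)
    (hu : u ≠ x) (hu' : ¬ G.Adj x u) : lazyWalk G α x u = 0 := by
  simp [lazyWalk, hu, hu']

lemma lazyWalk_nonneg (G : SimpleGraph V) [G.LocallyFinite] (α : ℝ) (h0 : 0 ≤ α) (h1 : α ≤ 1)
    (x u : V) : 0 ≤ lazyWalk G α x u := by
  unfold lazyWalk
  split_ifs
  · exact h0
  · exact div_nonneg (by linarith) (by positivity)
  · exact le_rfl

lemma lazyWalk_finsum (G : SimpleGraph V) [G.LocallyFinite] (α : ℝ) (x : V)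
    (hd : 0 < G.degree x) : ∑ᶠ u, lazyWalk G α x u = 1 := by
  classical
  have h := lazyWalk_sum G α x (fun _ => 1) (insert x (G.neighborFinset x)) (by simp)
    (fun u hu => by simp [hu])
  rw [finsum_eq_sum_of_support_subset (s := insert x (G.neighborFinset x))]
  · simp only [one_mul] at h
    rw [h]
    have : (G.degree x : ℝ) ≠ 0 := by exact_mod_cast hd.ne'
    simp
    field_simp
    ring
  · intro u hu
    by_contra hh
    simp at hh
    exact hu (lazyWalk_eq_zero G α x u hh.1 hh.2)

lemma lazyWalk_support_finite (G : SimpleGraph V) [G.LocallyFinite] (α : ℝ) (x : V) :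
    (Function.support (lazyWalk G α x)).Finite := by
  classical
  refine (insert x (G.neighborFinset x)).finite_toSet.subset ?_
  intro u hu
  by_contra hh
  simp at hh
  exact hu (lazyWalk_eq_zero G α x u hh.1 hh.2)

lemma lazyWalk_le_one (G : SimpleGraph V) [G.LocallyFinite] (α : ℝ) (h0 : 0 ≤ α) (h1 : α ≤ 1)
    (x u : V) (hd : 0 < G.degree x) : lazyWalk G α x u ≤ 1 := by
  have h := single_le_finsum u (lazyWalk_support_finite G α x) (lazyWalk_nonneg G α h0 h1 x)
  rwa [lazyWalk_finsum G α x hd] at h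

lemma transport_lower (G : SimpleGraph V) [G.LocallyFinite] (hconn : G.Connected) (α : ℝ)
    (h0 : 0 ≤ α) (h1 : α ≤ 1) (x y : V) (hdx : 0 < G.degree x) (hdy : 0 < G.degree y)
    (f : V → ℝ) (hf : ∀ p q, G.Adj p q → f q - f p ≤ 1) :
    (α * f y + (1 - α) / (G.degree y : ℝ) * ∑ p ∈ G.neighborFinset y, f p) -
    (α * f x + (1 - α) / (G.degree x : ℝ) * ∑ p ∈ G.neighborFinset x, f p) ≤
      transportDist G (lazyWalk G α x) (lazyWalk G α y) := by
  classical
  apply le_csInf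
  · refine ⟨_, fun p q => lazyWalk G α x p * lazyWalk G α y q, ⟨?_, ?_, ?_, ?_⟩, rfl⟩
    · refine ((lazyWalk_support_finite G α x).prod (lazyWalk_support_finite G α y)).subset ?_
      rintro ⟨p, q⟩ h
      simp only [Function.mem_support, ne_eq, mul_eq_zero, not_or] at h
      exact h
    · intro p q
      have a1 := lazyWalk_nonneg G α h0 h1 x p
      have a2 := lazyWalk_nonneg G α h0 h1 y q
      have a3 := lazyWalk_le_one G α h0 h1 x p hdx
      have a4 := lazyWalk_le_one G α h0 h1 y q hdy
      exact ⟨mul_nonneg a1 a2, mul_le_one₀ a3 a2 a4⟩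
    · intro p
      show (∑ᶠ q, lazyWalk G α x p * lazyWalk G α y q) = _
      rw [← mul_finsum, lazyWalk_finsum G α y hdy, mul_one]
    · intro q
      show (∑ᶠ p, lazyWalk G α x p * lazyWalk G α y q) = _
      rw [← finsum_mul, lazyWalk_finsum G α x hdx, one_mul]
  · rintro w ⟨A, ⟨hfin, hA, hr, hc⟩, rfl⟩
    let S : Finset V := (hfin.toFinset.image Prod.fst) ∪ (hfin.toFinset.image Prod.snd) ∪
      (insert x (G.neighborFinset x)) ∪ (insert y (G.neighborFinset y))
    have hS1 : ∀ p q, A p q ≠ 0 → p ∈ S ∧ q ∈ S := by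
      intro p q h
      have hm : (p, q) ∈ hfin.toFinset := by simpa using h
      have m1 : p ∈ hfin.toFinset.image Prod.fst := Finset.mem_image_of_mem Prod.fst hm
      have m2 : q ∈ hfin.toFinset.image Prod.snd := Finset.mem_image_of_mem Prod.snd hm
      simp only [S, Finset.mem_union]
      exact ⟨by tauto, by tauto⟩
    have e1 : ∀ p, ∑ q ∈ S, A p q = lazyWalk G α x p := by
      intro p
      rw [← hr p, finsum_eq_sum_of_support_subset]
      intro q hq; exact (hS1 p q hq).2
    have e2 : ∀ q, ∑ p ∈ S, A p q = lazyWalk G α y q := by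
      intro q
      rw [← hc q, finsum_eq_sum_of_support_subset]
      intro p hp; exact (hS1 p q hp).1
    have e3 : ∑ᶠ p : V × V, A p.1 p.2 * (G.dist p.1 p.2 : ℝ) =
        ∑ p ∈ S, ∑ q ∈ S, A p q * (G.dist p q : ℝ) := by
      rw [finsum_eq_sum_of_support_subset (s := S ×ˢ S), Finset.sum_product]
      rintro ⟨p, q⟩ h
      simp only [Function.mem_support, ne_eq, mul_eq_zero, not_or] at h
      have := hS1 p q h.1
      simp [this]
    have e4 : ∑ p ∈ S, ∑ q ∈ S, A p q * (f q - f p) ≤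
        ∑ p ∈ S, ∑ q ∈ S, A p q * (G.dist p q : ℝ) := by
      apply Finset.sum_le_sum; intro p _
      apply Finset.sum_le_sum; intro q _
      exact mul_le_mul_of_nonneg_left (lip_dist G hconn f hf p q) (hA p q).1
    have e5 : ∑ p ∈ S, ∑ q ∈ S, A p q * (f q - f p) =
        ∑ q ∈ S, f q * lazyWalk G α y q - ∑ p ∈ S, f p * lazyWalk G α x p := by
      simp only [mul_sub, Finset.sum_sub_distrib]
      congr 1
      · rw [Finset.sum_comm]
        apply Finset.sum_congr rfl; intro q _
        rw [← Finset.sum_mul, e2, mul_comm]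
      · apply Finset.sum_congr rfl; intro p _
        rw [← Finset.sum_mul, e1, mul_comm]
    rw [e3]
    refine le_trans (le_of_eq ?_) e4
    rw [e5, lazyWalk_sum G α y f S (by simp [S]) (fun u hu => by simp [S, hu]),
      lazyWalk_sum G α x f S (by simp [S]) (fun u hu => by simp [S, hu])]

open Classical in
/-- The basic consequence of positive curvature along the edge `xy`. -/
theorem curv_ineq (G : SimpleGraph V) [G.LocallyFinite] (hconn : G.Connected)
    (hpos : PositivelyCurved G) (x y : V) (hxy : G.Adj x y) (T N : Finset V)
    (hT : ∀ u ∈ T, G.Adj y u ∧ u ≠ x)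
    (hN : ∀ z, G.Adj x z → (z = y ∨ G.Adj y z ∨ z ∈ T ∨ ∃ u ∈ T, G.Adj u z) → z ∈ N) :
    G.degree x * T.card < G.degree y * (N.card + 1 + (T.filter (G.Adj x)).card) := by
  have hdx : 0 < G.degree x := (G.degree_pos_iff_exists_adj x).2 ⟨y, hxy⟩
  have hdy : 0 < G.degree y := (G.degree_pos_iff_exists_adj y).2 ⟨x, hxy.symm⟩
  have hdx' : (0 : ℝ) < G.degree x := by exact_mod_cast hdx
  have hdy' : (0 : ℝ) < G.degree y := by exact_mod_cast hdy
  obtain ⟨κ, hκ, hlim⟩ := hpos hxy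
  let f : V → ℝ := fun p => if p = y ∨ p ∈ T then 1 else if G.Adj x p ∧ p ∉ N then -1 else 0
  have hf : ∀ p q, G.Adj p q → f q - f p ≤ 1 := by
    intro p q hpq
    simp only [f]
    by_cases hq : q = y ∨ q ∈ T
    · have : ¬ (G.Adj x p ∧ p ∉ N) := by
        rintro ⟨h1, h2⟩
        apply h2
        apply hN p h1
        rcases hq with rfl | hq
        · exact Or.inr (Or.inl hpq.symm)
        · exact Or.inr (Or.inr (Or.inr ⟨q, hq, hpq.symm⟩))
      rw [if_pos hq, if_neg this]
      split_ifs <;> norm_num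
    · rw [if_neg hq]
      split_ifs <;> norm_num
  have hxT : x ∉ T := fun h => (hT x h).2 rfl
  have hfx : f x = 0 := by simp [f, hxy.ne, hxT]
  have hfy : f y = 1 := by simp [f]
  have hsy : ∑ p ∈ G.neighborFinset y, f p = T.card := by
    have hTs : T ⊆ G.neighborFinset y := fun u hu => by simpa using (hT u hu).1
    rw [← Finset.sum_subset hTs]
    · rw [Finset.sum_congr rfl (g := fun _ => (1 : ℝ))]
      · simp
      · intro u hu; simp [f, hu]
    · intro u hu hu'
      rw [SimpleGraph.mem_neighborFinset] at hu
      have : ¬ (G.Adj x u ∧ u ∉ N) := fun h => h.2 (hN u h.1 (Or.inr (Or.inl hu)))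
      simp only [f]
      rw [if_neg (by simp [hu', hu.ne']), if_neg this]
  have hsx : ∑ p ∈ G.neighborFinset x, f p ≤
      1 + ((T.filter (G.Adj x)).card : ℝ) - (G.degree x - N.card) := by
    have hle : ∀ p ∈ G.neighborFinset x, f p ≤ (if p = y then 1 else 0) +
        (if p ∈ T then 1 else 0) - (1 - if p ∈ N then 1 else 0) := by
      intro p hp
      rw [SimpleGraph.mem_neighborFinset] at hp
      by_cases h1 : p = y
      · have := hN p hp (Or.inl h1)
        simp only [f, h1, true_or, if_true]
        rw [← h1, if_pos this]
        split_ifs <;> norm_num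
      · by_cases h2 : p ∈ T
        · have := hN p hp (Or.inr (Or.inr (Or.inl h2)))
          simp [f, h1, h2, this]
        · by_cases h3 : p ∈ N <;> simp [f, h1, h2, h3, hp]
    refine (Finset.sum_le_sum hle).trans ?_
    rw [Finset.sum_sub_distrib, Finset.sum_add_distrib, Finset.sum_sub_distrib]
    have c1 : ∑ p ∈ G.neighborFinset x, (if p = y then (1 : ℝ) else 0) ≤ 1 := by
      rw [Finset.sum_ite_eq']; split_ifs <;> norm_num
    have c2 : ∑ p ∈ G.neighborFinset x, (if p ∈ T then (1 : ℝ) else 0) ≤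
        ((T.filter (G.Adj x)).card : ℝ) := by
      rw [Finset.sum_boole]
      norm_cast
      apply Finset.card_le_card
      intro u hu
      simp at hu ⊢
      exact ⟨hu.2, hu.1⟩
    have c3 : ∑ p ∈ G.neighborFinset x, (if p ∈ N then (1 : ℝ) else 0) ≤ N.card := by
      rw [Finset.sum_boole]
      norm_cast
      apply Finset.card_le_card
      intro u hu
      simp at hu
      exact hu.2
    have c4 : ∑ p ∈ G.neighborFinset x, (1 : ℝ) = G.degree x := by simp
    linarith
  set τ := (T.filter (G.Adj x)).card
  have hbound : κ ≤ 1 - (T.card : ℝ) / G.degree y + (1 + τ - (G.degree x - N.card)) / G.degree x := by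
    refine le_of_tendsto hlim ?_
    have : Set.Ioo (0 : ℝ) 1 ∈ nhdsWithin (1 : ℝ) (Set.Iio 1) := Ioo_mem_nhdsLT zero_lt_one
    filter_upwards [this] with α hα
    have h1 : 0 < 1 - α := by linarith [hα.2]
    rw [div_le_iff₀ h1, alphaRicci, SimpleGraph.dist_eq_one_iff_adj.2 hxy]
    have ht := transport_lower G hconn α hα.1.le hα.2.le x y hdx hdy f hf
    rw [hfx, hfy, hsy] at ht
    have h2 : (1 - α) / (G.degree x : ℝ) * ∑ p ∈ G.neighborFinset x, f p ≤
        (1 - α) / (G.degree x : ℝ) * (1 + τ - (G.degree x - N.card)) :=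
      mul_le_mul_of_nonneg_left hsx (by positivity)
    have h3 : (1 - (T.card : ℝ) / G.degree y + (1 + τ - (G.degree x - N.card)) / G.degree x) * (1 - α)
        = (1 - α) - (1 - α) / G.degree y * T.card +
          (1 - α) / (G.degree x : ℝ) * (1 + τ - (G.degree x - N.card)) := by ring
    rw [h3]
    simp only [Nat.cast_one, div_one]
    linarith
  have hfin : 0 < 1 - (T.card : ℝ) / G.degree y + (1 + τ - (G.degree x - N.card)) / G.degree x :=
    lt_of_lt_of_le hκ hbound
  have h4 : (T.card : ℝ) / G.degree y < (N.card + 1 + τ) / G.degree x := by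
    have : (1 + τ - (G.degree x - N.card : ℝ)) / G.degree x =
      (N.card + 1 + τ) / G.degree x - 1 := by field_simp; ring
    rw [this] at hfin
    linarith
  rw [div_lt_div_iff₀ hdy' hdx'] at h4
  have h5 : (G.degree x : ℝ) * T.card < G.degree y * (N.card + 1 + τ) := by linarith
  exact_mod_cast h5


/-- The combinatorial configuration around the vertex `x`. -/
structure Cfg (G : SimpleGraph V) [G.LocallyFinite] (x : V) (t : ℤ) (v : ℤ → V) : Prop where
  t18 : 18 ≤ t
  adj : ∀ i, G.Adj x (v i)
  per : ∀ i, v (i + t) = v i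
  surj : ∀ u, G.Adj x u → ∃ i : ℤ, v i = u
  inj : ∀ i j, v i = v j → t ∣ i - j
  nc : NonCrossing G x t v
  deg3 : ∀ u, 3 ≤ G.degree u
  conn : G.Connected
  pos : PositivelyCurved G
  dx : (G.degree x : ℤ) = t

/-- Caps with respect to the cyclic order `v`. -/
def Cap (G : SimpleGraph V) (x : V) (t : ℤ) (v : ℤ → V) (a b : ℤ) : Prop :=
  a < b ∧ b < a + t ∧ (G.Adj (v a) (v b) ∨
    ∃ z, z ≠ x ∧ ¬ G.Adj x z ∧ G.Adj (v a) z ∧ G.Adj (v b) z ∧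
      ∀ i, a < i → i < b → ¬ G.Adj (v i) z)

section CfgLemmas

variable {G : SimpleGraph V} [G.LocallyFinite] {x : V} {t : ℤ} {v : ℤ → V}

theorem Cfg.ne (C : Cfg G x t v) {a b : ℤ} (h1 : a < b) (h2 : b < a + t) : v a ≠ v b := by
  intro h
  have h3 := C.inj b a h.symm
  have := Int.le_of_dvd (by omega) h3
  omega

theorem Cfg.nex (C : Cfg G x t v) (a : ℤ) : v a ≠ x := (C.adj a).ne'

theorem Cfg.perm (C : Cfg G x t v) (a n : ℤ) : v (a + n * t) = v a := by
  induction n using Int.induction_on with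
  | zero => simp
  | succ n ih => rw [add_mul, one_mul, ← add_assoc, C.per, ih]
  | pred n ih => rw [← C.per, ← ih]; congr 1; ring

theorem Cfg.rep (C : Cfg G x t v) (a m : ℤ) : ∃ m', a ≤ m' ∧ m' < a + t ∧ v m' = v m := by
  have ht : 0 < t := by have := C.t18; omega
  refine ⟨a + (m - a) % t, ?_, ?_, ?_⟩
  · have := Int.emod_nonneg (m - a) ht.ne'
    omega
  · have := Int.emod_lt_of_pos (m - a) ht
    omega
  · rw [← C.perm (a + (m - a) % t) ((m - a) / t)]
    congr 1
    have := Int.emod_add_mul_ediv (m - a) t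
    linarith

/-- The region enclosed by a cap. -/
theorem Cfg.region (C : Cfg G x t v) {a b j m : ℤ} {u : V} (h : Cap G x t v a b) (h1 : a < j)
    (h2 : j < b) (hux : u ≠ x) (hu : u = v j ∨ (G.Adj (v j) u ∧ ¬ G.Adj x u))
    (hm : G.Adj u (v m)) : ∃ m', a ≤ m' ∧ m' ≤ b ∧ v m' = v m := by
  obtain ⟨m', h3, h4, h5⟩ := C.rep a m
  by_cases hb : m' ≤ b
  · exact ⟨m', h3, hb, h5⟩
  exfalso
  push Not at hb
  obtain ⟨hab, hbt, hc⟩ := h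
  rw [← h5] at hm
  have hu1 : u = v j ∨ G.Adj (v j) u := hu.imp id And.left
  have hua : u ≠ v a := by
    rintro rfl
    rcases hu with hu | hu
    · exact C.ne h1 (by omega) hu
    · exact hu.2 (C.adj _)
  have hub : u ≠ v b := by
    rintro rfl
    rcases hu with hu | hu
    · exact C.ne h2 (by omega) hu.symm
    · exact hu.2 (C.adj _)
  rcases hc with hc | ⟨z, hz1, hz2, hz3, hz4, hz5⟩
  · exact C.nc a j b m' h1 h2 hb h4 (v a) u (C.nex a) hux (Or.inl rfl) hc hu1 hm hua.symm
      (C.ne h1 (by omega)) (C.ne (by omega) h4) hua hub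
  · refine C.nc a j b m' h1 h2 hb h4 z u hz1 hux (Or.inr hz3) hz4.symm hu1 hm ?_ ?_ ?_ hua hub
    · rintro rfl
      rcases hu with hu | hu
      · exact hz2 (hu ▸ C.adj j)
      · exact hz5 j h1 h2 hu.1
    · rintro rfl; exact hz2 (C.adj _)
    · rintro rfl; exact hz2 (C.adj _)

theorem Cfg.cap_of_common (C : Cfg G x t v) {p q : ℤ} {u : V} (hpq : p < q) (hqt : q < p + t)
    (hux : u ≠ x) (hu : ¬ G.Adj x u) (hp : G.Adj (v p) u) (hq : G.Adj (v q) u) :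
    ∃ q', p < q' ∧ q' ≤ q ∧ G.Adj (v q') u ∧ Cap G x t v p q' := by
  classical
  have hex : ∃ n : ℕ, 0 < n ∧ G.Adj (v (p + n)) u := by
    refine ⟨(q - p).toNat, by omega, ?_⟩
    have : p + ((q - p).toNat : ℤ) = q := by omega
    rw [this]; exact hq
  have hs := Nat.find_spec hex
  have hle : (Nat.find hex : ℤ) ≤ q - p := by
    have := Nat.find_min' hex (m := (q - p).toNat) ⟨by omega, by
      have : p + ((q - p).toNat : ℤ) = q := by omega
      rw [this]; exact hq⟩
    omega
  have hmin : ∀ n : ℕ, n < Nat.find hex → ¬ (0 < n ∧ G.Adj (v (p + n)) u) :=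
    fun n hn => Nat.find_min hex hn
  generalize Nat.find hex = n at hs hle hmin
  refine ⟨p + n, by omega, by omega, hs.2, by omega, by omega, Or.inr ⟨u, hux, hu, hp, hs.2, ?_⟩⟩
  intro i hi1 hi2 hi
  refine hmin (i - p).toNat (by omega) ⟨by omega, ?_⟩
  have : p + ((i - p).toNat : ℤ) = i := by omega
  rw [this]; exact hi

theorem Cfg.cap_arc {a b : ℤ} (h1 : a < b) (h2 : b < a + t)
    (h : G.Adj (v a) (v b)) : Cap G x t v a b := ⟨h1, h2, Or.inl h⟩

/-- Curvature inequality, with an arbitrary test set. -/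
theorem Cfg.curvT (C : Cfg G x t v) (j : ℤ) (T : Finset V) (N : List ℤ) (s : ℕ)
    (hT : ∀ u ∈ T, G.Adj (v j) u ∧ u ≠ x)
    (hj : j ∈ N) (hA : ∀ m, G.Adj (v j) (v m) → ∃ m' ∈ N, v m' = v m)
    (hB : ∀ u ∈ T, ∀ m, G.Adj u (v m) → ∃ m' ∈ N, v m' = v m)
    (hs : ∀ T' : Finset V, (∀ u ∈ T', u ∈ T ∧ G.Adj x u) → T'.card ≤ s) (c : ℕ)
    (hc : N.length + 1 + s ≤ c) :
    18 * T.card < G.degree (v j) * c := by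
  classical
  have h := curv_ineq G C.conn C.pos x (v j) (C.adj j) T (N.toFinset.image v) hT (by
    intro z hz hz2
    obtain ⟨m, rfl⟩ := C.surj z hz
    have : ∃ m' ∈ N, v m' = v m := by
      rcases hz2 with h | h | h | ⟨u, h, h'⟩
      · exact ⟨j, hj, h.symm⟩
      · exact hA m h
      · exact hA m (hT _ h).1
      · exact hB u h m h'
    obtain ⟨m', h1, h2⟩ := this
    exact Finset.mem_image.2 ⟨m', by simpa using h1, h2⟩)
  have h1 : (N.toFinset.image v).card ≤ N.length :=
    Finset.card_image_le.trans (List.toFinset_card_le _)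
  have h2 : (T.filter (G.Adj x)).card ≤ s := hs _ (fun u hu => by simpa using hu)
  have h3 : 18 ≤ G.degree x := by have := C.t18; have := C.dx; omega
  calc 18 * T.card ≤ G.degree x * T.card := Nat.mul_le_mul_right _ h3
    _ < _ := h
    _ ≤ _ := Nat.mul_le_mul_left _ (by omega)

open Classical in
/-- Curvature inequality, where the test set is the complement of `F` in the neighborhood. -/
theorem Cfg.curvF (C : Cfg G x t v) (j : ℤ) (F : Finset V) (N R : List ℤ) (hx : x ∈ F)
    (hj : j ∈ N) (hA : ∀ m, G.Adj (v j) (v m) → ∃ m' ∈ N, v m' = v m)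
    (hB : ∀ u, u ∉ F → G.Adj (v j) u → u ≠ x → ∀ m, G.Adj u (v m) → ∃ m' ∈ N, v m' = v m)
    (hR : ∀ m, G.Adj (v j) (v m) → v m ∉ F → ∃ m' ∈ R, v m' = v m) (c : ℕ)
    (hc : N.length + 1 + R.length ≤ c) :
    18 * (G.neighborFinset (v j) \ F).card < G.degree (v j) * c ∧
      G.degree (v j) ≤ (G.neighborFinset (v j) \ F).card + F.card := by
  have hux : ∀ u, u ∉ F → u ≠ x := fun u hu h => hu (h ▸ hx)
  constructor
  · refine C.curvT j _ N R.length ?_ hj hA ?_ ?_ c hc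
    · intro u hu
      simp only [Finset.mem_sdiff, SimpleGraph.mem_neighborFinset] at hu
      exact ⟨hu.1, hux u hu.2⟩
    · intro u hu
      simp only [Finset.mem_sdiff, SimpleGraph.mem_neighborFinset] at hu
      exact hB u hu.2 hu.1 (hux u hu.2)
    · intro T' hT'
      have : T' ⊆ R.toFinset.image v := by
        intro u hu
        obtain ⟨h1, h2⟩ := hT' u hu
        simp only [Finset.mem_sdiff, SimpleGraph.mem_neighborFinset] at h1
        obtain ⟨m, rfl⟩ := C.surj u h2
        obtain ⟨m', h3, h4⟩ := hR m h1.1 h1.2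
        exact Finset.mem_image.2 ⟨m', by simpa using h3, h4⟩
      exact (Finset.card_le_card this).trans
        (Finset.card_image_le.trans (List.toFinset_card_le _))
  · rw [← SimpleGraph.card_neighborFinset_eq_degree]
    have := Finset.le_card_sdiff F (G.neighborFinset (v j))
    omega

/-- Structure of 2-caps. -/
theorem Cfg.two_cap (C : Cfg G x t v) {a : ℤ} (h : Cap G x t v a (a + 2)) :
    G.degree (v (a + 1)) = 3 ∧ G.Adj (v (a + 1)) (v a) ∧ G.Adj (v (a + 1)) (v (a + 2)) ∧
      ∀ u, G.Adj (v (a + 1)) u → u = x ∨ u = v a ∨ u = v (a + 2) := by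
  classical
  let F : Finset V := {x, v a, v (a + 2)}
  have hreg : ∀ m, G.Adj (v (a + 1)) (v m) → ∃ m' ∈ [a, a + 1, a + 2], v m' = v m := by
    intro m hm
    obtain ⟨m', h1, h2, h3⟩ := C.region h (j := a + 1) (by omega) (by omega) (C.nex _)
      (Or.inl rfl) hm
    exact ⟨m', by simp only [List.mem_cons, List.not_mem_nil, or_false]; omega, h3⟩
  have hterm : ∀ m, G.Adj (v (a + 1)) (v m) → v m ∈ F := by
    intro m hm
    obtain ⟨m', h1, h3⟩ := hreg m hm
    rw [← h3] at hm ⊢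
    simp only [List.mem_cons, List.not_mem_nil, or_false] at h1
    rcases h1 with rfl | rfl | rfl
    · simp [F]
    · exact absurd hm (G.irrefl)
    · simp [F]
  have hF : F.card ≤ 3 := Finset.card_le_three
  obtain ⟨h1, h2⟩ := C.curvF (a + 1) F [a, a + 1, a + 2] [] (by simp [F]) (by simp) hreg (by
      intro u hu hu2 hux m hm
      obtain ⟨m', h1, h2, h3⟩ := C.region h (j := a + 1) (u := u) (by omega) (by omega) hux
        (Or.inr ⟨hu2, fun h => by
          obtain ⟨i, rfl⟩ := C.surj u h
          exact hu (hterm i hu2)⟩) hm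
      exact ⟨m', by simp only [List.mem_cons, List.not_mem_nil, or_false]; omega, h3⟩)
    (fun m hm hm2 => absurd (hterm m hm) hm2) 4 (by simp)
  have h3 : (G.neighborFinset (v (a + 1)) \ F).card = 0 := by omega
  have h4 : G.neighborFinset (v (a + 1)) ⊆ F := by
    rw [Finset.card_eq_zero] at h3
    exact Finset.sdiff_eq_empty_iff_subset.1 h3
  have h5 := C.deg3 (v (a + 1))
  have h6 : G.neighborFinset (v (a + 1)) = F := Finset.eq_of_subset_of_card_le h4 (by
    rw [SimpleGraph.card_neighborFinset_eq_degree]; omega)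
  have h7 : ∀ u, G.Adj (v (a + 1)) u ↔ u ∈ F := by
    intro u; rw [← h6, SimpleGraph.mem_neighborFinset]
  refine ⟨by omega, (h7 _).2 (by simp [F]), (h7 _).2 (by simp [F]), fun u hu => ?_⟩
  simpa [F] using (h7 u).1 hu

theorem Cfg.two_cap_arcs (C : Cfg G x t v) {a : ℤ} (h : Cap G x t v a (a + 2)) (N : List ℤ)
    (h0 : a ∈ N) (h2 : a + 2 ∈ N) :
    ∀ m, G.Adj (v (a + 1)) (v m) → ∃ m' ∈ N, v m' = v m := by
  intro m hm
  rcases (C.two_cap h).2.2.2 _ hm with h | h | h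
  · exact absurd h (C.nex _)
  · exact ⟨a, h0, h.symm⟩
  · exact ⟨a + 2, h2, h.symm⟩

theorem Cfg.two_both (C : Cfg G x t v) {a : ℤ} (h : Cap G x t v a (a + 2)) (N : List ℤ)
    (hN : N.length ≤ 9) (h0 : a ∈ N) (h1 : a + 1 ∈ N) (h2 : a + 2 ∈ N)
    (ha : ∀ m, G.Adj (v a) (v m) → ∃ m' ∈ N, v m' = v m)
    (hb : ∀ m, G.Adj (v (a + 2)) (v m) → ∃ m' ∈ N, v m' = v m) : False := by
  classical
  obtain ⟨hd, e1, e2, -⟩ := C.two_cap h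
  have hne : v a ≠ v (a + 2) := C.ne (by omega) (by have := C.t18; omega)
  have hcard : ({v a, v (a + 2)} : Finset V).card = 2 := Finset.card_pair hne
  have := C.curvT (a + 1) {v a, v (a + 2)} N 2 (by
    intro u hu
    simp only [Finset.mem_insert, Finset.mem_singleton] at hu
    rcases hu with rfl | rfl
    · exact ⟨e1, C.nex _⟩
    · exact ⟨e2, C.nex _⟩) h1 (C.two_cap_arcs h N h0 h2) (by
    intro u hu
    simp only [Finset.mem_insert, Finset.mem_singleton] at hu
    rcases hu with rfl | rfl
    · exact ha
    · exact hb) (fun T' hT' => by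
      rw [← hcard]; exact Finset.card_le_card fun u hu => (hT' u hu).1) 12 (by omega)
  rw [hd, hcard] at this
  omega

theorem Cfg.two_one (C : Cfg G x t v) {a r : ℤ} (h : Cap G x t v a (a + 2)) (N : List ℤ)
    (hN : N.length ≤ 4) (h0 : a ∈ N) (h1 : a + 1 ∈ N) (h2 : a + 2 ∈ N) (hr : r = a ∨ r = a + 2)
    (ha : ∀ m, G.Adj (v r) (v m) → ∃ m' ∈ N, v m' = v m) : False := by
  classical
  obtain ⟨hd, e1, e2, -⟩ := C.two_cap h
  have hcard : ({v r} : Finset V).card = 1 := Finset.card_singleton _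
  have := C.curvT (a + 1) {v r} N 1 (by
    intro u hu
    simp only [Finset.mem_singleton] at hu
    subst hu
    rcases hr with rfl | rfl
    · exact ⟨e1, C.nex _⟩
    · exact ⟨e2, C.nex _⟩) h1 (C.two_cap_arcs h N h0 h2) (by
    intro u hu
    simp only [Finset.mem_singleton] at hu
    subst hu
    exact ha) (fun T' hT' => by
      rw [← hcard]; exact Finset.card_le_card fun u hu => (hT' u hu).1) 6 (by omega)
  rw [hd, hcard] at this
  omega

/-- Structure of 4-caps. -/
theorem Cfg.four_cap (C : Cfg G x t v) {p : ℤ} (h : Cap G x t v p (p + 4)) :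
    G.Adj (v p) (v (p + 2)) ∧ G.Adj (v (p + 2)) (v (p + 4)) := by
  classical
  have ht := C.t18
  have hreg : ∀ j, p < j → j < p + 4 → ∀ m, G.Adj (v j) (v m) →
      ∃ m', p ≤ m' ∧ m' ≤ p + 4 ∧ v m' = v m := fun j h1 h2 m hm =>
    C.region h h1 h2 (C.nex _) (Or.inl rfl) hm
  by_cases h1 : G.Adj (v p) (v (p + 2)) <;> by_cases h2 : G.Adj (v (p + 2)) (v (p + 4))
  · exact ⟨h1, h2⟩
  · exfalso
    refine C.two_one (a := p) (r := p + 2) (Cfg.cap_arc (by omega) (by omega) h1)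
      [p, p + 1, p + 2, p + 3] (by simp) (by simp) (by simp) (by simp) (Or.inr rfl) ?_
    intro m hm
    obtain ⟨m', h3, h4, h5⟩ := hreg _ (by omega) (by omega) m hm
    refine ⟨m', ?_, h5⟩
    have : m' ≠ p + 4 := by rintro rfl; exact h2 (h5 ▸ hm)
    simp only [List.mem_cons, List.not_mem_nil, or_false]; omega
  · exfalso
    have h2' : G.Adj (v (p + 2)) (v (p + 2 + 2)) := by
      rw [add_assoc]; exact h2
    refine C.two_one (a := p + 2) (r := p + 2) (Cfg.cap_arc (by omega) (by omega) h2')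
      [p + 2, p + 2 + 1, p + 2 + 2, p + 1] (by simp) (by simp) (by simp) (by simp) (Or.inl rfl) ?_
    intro m hm
    obtain ⟨m', h3, h4, h5⟩ := hreg _ (by omega) (by omega) m hm
    refine ⟨m', ?_, h5⟩
    have : m' ≠ p := by rintro rfl; exact h1 (h5 ▸ hm).symm
    simp only [List.mem_cons, List.not_mem_nil, or_false]; omega
  · exfalso
    have harc : ∀ m, G.Adj (v (p + 2)) (v m) → ∃ m' ∈ [p + 1, p + 3], v m' = v m := by
      intro m hm
      obtain ⟨m', h3, h4, h5⟩ := hreg _ (by omega) (by omega) m hm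
      refine ⟨m', ?_, h5⟩
      rw [← h5] at hm
      have n1 : m' ≠ p := by rintro rfl; exact h1 hm.symm
      have n2 : m' ≠ p + 2 := by rintro rfl; exact G.irrefl hm
      have n3 : m' ≠ p + 4 := by rintro rfl; exact h2 hm
      simp only [List.mem_cons, List.not_mem_nil, or_false]; omega
    obtain ⟨e1, e2⟩ := C.curvF (p + 2) {x} [p, p + 1, p + 2, p + 3, p + 4] [p + 1, p + 3]
      (by simp) (by simp) (fun m hm => by
        obtain ⟨m', h3, h5⟩ := harc m hm
        refine ⟨m', ?_, h5⟩
        simp only [List.mem_cons, List.not_mem_nil, or_false] at h3 ⊢; omega) (by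
        intro u hu hu2 hux m hm
        have : ∃ m', p ≤ m' ∧ m' ≤ p + 4 ∧ v m' = v m := by
          by_cases hxu : G.Adj x u
          · obtain ⟨i, rfl⟩ := C.surj u hxu
            obtain ⟨i', h3, h5⟩ := harc i hu2
            rw [← h5] at hm
            simp only [List.mem_cons, List.not_mem_nil, or_false] at h3
            exact hreg i' (by omega) (by omega) m hm
          · exact C.region h (j := p + 2) (by omega) (by omega) hux (Or.inr ⟨hu2, hxu⟩) hm
        obtain ⟨m', h3, h4, h5⟩ := this
        refine ⟨m', ?_, h5⟩
        simp only [List.mem_cons, List.not_mem_nil, or_false]; omega)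
      (fun m hm _ => harc m hm) 8 (by simp)
    have := C.deg3 (v (p + 2))
    simp only [Finset.card_singleton] at e2
    omega

/-- A minimal violating cap. -/
structure Viol (G : SimpleGraph V) (x : V) (t : ℤ) (v : ℤ → V) (k n : ℤ) : Prop where
  n1 : n ≠ 1
  n2 : n ≠ 2
  n4 : n ≠ 4
  cap : Cap G x t v k (k + n)
  ih : ∀ a b, k ≤ a → b ≤ k + n → b - a < n → Cap G x t v a b →
    b = a + 1 ∨ b = a + 2 ∨ b = a + 4

theorem Viol.n3 {k n : ℤ} (W : Viol G x t v k n) : 3 ≤ n ∧ n < t := by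
  have := W.cap.1
  have := W.cap.2.1
  have := W.n1
  have := W.n2
  omega

/-- Arcs inside a minimal violating cap. -/
theorem Viol.arc (C : Cfg G x t v) {k n : ℤ} (W : Viol G x t v k n) {j m : ℤ} (h1 : k < j)
    (h2 : j < k + n) (h : G.Adj (v j) (v m)) : ∃ m', k ≤ m' ∧ m' ≤ k + n ∧ v m' = v m ∧
    G.Adj (v j) (v m') ∧
    ((m' = j + 1 ∨ m' = j + 2 ∨ m' = j + 4 ∨ m' = j - 1 ∨ m' = j - 2 ∨ m' = j - 4)) := by
  obtain ⟨m', h3, h4, h5⟩ := C.region W.cap h1 h2 (C.nex _) (Or.inl rfl) h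
  rw [← h5] at h
  have hn := W.n3
  refine ⟨m', h3, h4, h5, h, ?_⟩
  rcases lt_trichotomy m' j with hl | hl | hl
  · have := W.ih m' j h3 (by omega) (by omega) (Cfg.cap_arc hl (by omega) h.symm)
    omega
  · subst hl; exact absurd h G.irrefl
  · have := W.ih j m' (by omega) h4 (by omega) (Cfg.cap_arc hl (by omega) h)
    omega

theorem Viol.s1 (C : Cfg G x t v) {k n : ℤ} (W : Viol G x t v k n) {p : ℤ} (h1 : k < p)
    (h2 : p + 2 < k + n) (h : Cap G x t v p (p + 2)) : False := by
  refine C.two_both h [p - 4, p - 2, p - 1, p, p + 1, p + 2, p + 3, p + 4, p + 6]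
    (by simp) (by simp) (by simp) (by simp) ?_ ?_
  · intro m hm
    obtain ⟨m', -, -, h5, -, h6⟩ := W.arc C h1 (by omega) hm
    refine ⟨m', ?_, h5⟩
    simp only [List.mem_cons, List.not_mem_nil, or_false]; omega
  · intro m hm
    obtain ⟨m', -, -, h5, -, h6⟩ := W.arc C (by omega) h2 hm
    refine ⟨m', ?_, h5⟩
    simp only [List.mem_cons, List.not_mem_nil, or_false]; omega

theorem Viol.s2 (C : Cfg G x t v) {k n : ℤ} (W : Viol G x t v k n) {p : ℤ} (h1 : k ≤ p)
    (h2 : p + 4 ≤ k + n) (h : Cap G x t v p (p + 4)) : False := by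
  have ht := C.t18
  have hn := W.n4
  obtain ⟨e1, e2⟩ := C.four_cap h
  have e2' : G.Adj (v (p + 2)) (v (p + 2 + 2)) := by rw [add_assoc]; exact e2
  by_cases hp : k < p
  · exact W.s1 C hp (by omega) (Cfg.cap_arc (by omega) (by omega) e1)
  · exact W.s1 C (p := p + 2) (by omega) (by omega) (Cfg.cap_arc (by omega) (by omega) e2')

theorem Viol.s3 (C : Cfg G x t v) {k n : ℤ} (W : Viol G x t v k n) {p : ℤ} (h1 : k ≤ p)
    (h2 : p + 2 ≤ k + n) (h : Cap G x t v p (p + 2)) : False := by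
  have ht := C.t18
  have hn := W.n4
  have hn3 := W.n3
  by_cases hp : k < p
  · by_cases hp2 : p + 2 < k + n
    · exact W.s1 C hp hp2 h
    refine C.two_one (r := p) h [p, p + 1, p + 2, p - 1] (by simp) (by simp) (by simp) (by simp)
      (Or.inl rfl) ?_
    intro m hm
    obtain ⟨m', h3, h4, h5, h7, h6⟩ := W.arc C hp (by omega) hm
    refine ⟨m', ?_, h5⟩
    have a1 : m' ≠ p - 2 := by
      rintro rfl
      refine W.s1 C (p := p - 2) (by omega) (by omega) (Cfg.cap_arc (by omega) (by omega) ?_)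
      rw [sub_add_cancel]; exact h7.symm
    have a2 : m' ≠ p - 4 := by
      rintro rfl
      refine W.s2 C (p := p - 4) (by omega) (by omega) (Cfg.cap_arc (by omega) (by omega) ?_)
      rw [sub_add_cancel]; exact h7.symm
    simp only [List.mem_cons, List.not_mem_nil, or_false]; omega
  · refine C.two_one (r := p + 2) h [p, p + 1, p + 2, p + 3] (by simp) (by simp) (by simp)
      (by simp) (Or.inr rfl) ?_
    intro m hm
    obtain ⟨m', h3, h4, h5, h7, h6⟩ := W.arc C (j := p + 2) (by omega) (by omega) hm
    refine ⟨m', ?_, h5⟩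
    have a1 : m' ≠ p + 2 + 2 := by
      rintro rfl
      exact W.s1 C (p := p + 2) (by omega) (by omega) (Cfg.cap_arc (by omega) (by omega) h7)
    have a2 : m' ≠ p + 2 + 4 := by
      rintro rfl
      exact W.s2 C (p := p + 2) (by omega) (by omega) (Cfg.cap_arc (by omega) (by omega) h7)
    simp only [List.mem_cons, List.not_mem_nil, or_false]; omega

theorem Viol.s4 (C : Cfg G x t v) {k n : ℤ} (W : Viol G x t v k n) {a b : ℤ} (h1 : k ≤ a)
    (h2 : b ≤ k + n) (h3 : b - a < n) (h : Cap G x t v a b) : b = a + 1 := by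
  rcases W.ih a b h1 h2 h3 h with h4 | h4 | h4
  · exact h4
  · subst h4; exact (W.s3 C h1 h2 h).elim
  · subst h4; exact (W.s2 C h1 h2 h).elim

theorem Viol.arc1 (C : Cfg G x t v) {k n : ℤ} (W : Viol G x t v k n) {j m : ℤ} (h1 : k < j)
    (h2 : j < k + n) (h : G.Adj (v j) (v m)) : ∃ m', k ≤ m' ∧ m' ≤ k + n ∧ v m' = v m ∧
    G.Adj (v j) (v m') ∧ (m' = j + 1 ∨ m' = j - 1) := by
  obtain ⟨m', h3, h4, h5, h6, h7⟩ := W.arc C h1 h2 h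
  have hn := W.n3
  refine ⟨m', h3, h4, h5, h6, ?_⟩
  by_cases hl : m' < j
  · have := W.s4 C h3 (by omega : j ≤ k + n) (by omega) (Cfg.cap_arc hl (by omega) h6.symm)
    omega
  · have := W.s4 C (by omega : k ≤ j) h4 (by omega) (Cfg.cap_arc (by omega) (by omega) h6)
    omega

theorem Viol.contig (C : Cfg G x t v) {k n : ℤ} (W : Viol G x t v k n) {p q : ℤ} {u : V}
    (h1 : k ≤ p) (hpq : p < q) (h2 : q ≤ k + n) (h3 : q - p < n)
    (hux : u ≠ x) (hu : ¬ G.Adj x u) (hp : G.Adj (v p) u) (hq : G.Adj (v q) u) :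
    G.Adj (v (p + 1)) u := by
  have hn := W.n3
  obtain ⟨q', e1, e2, e3, e4⟩ := C.cap_of_common hpq (by omega) hux hu hp hq
  have := W.s4 C h1 (by omega) (by omega) e4
  rw [← this]; exact e3

theorem Viol.not3 (C : Cfg G x t v) {k : ℤ} (W : Viol G x t v k 3) : False := by
  classical
  obtain ⟨e1, e2⟩ := C.curvF (k + 1) {x, v k} [k, k + 1, k + 2, k + 3] [k + 2]
    (by simp) (by simp) (fun m hm => by
      obtain ⟨m', h3, h4, h5, -, -⟩ := W.arc1 C (j := k + 1) (by omega) (by omega) hm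
      refine ⟨m', ?_, h5⟩
      simp only [List.mem_cons, List.not_mem_nil, or_false]; omega) (by
      intro u hu hu2 hux m hm
      have : ∃ m', k ≤ m' ∧ m' ≤ k + 3 ∧ v m' = v m := by
        by_cases hxu : G.Adj x u
        · obtain ⟨i, rfl⟩ := C.surj u hxu
          obtain ⟨i', h3, h4, h5, -, h6⟩ := W.arc1 C (j := k + 1) (by omega) (by omega) hu2
          rw [← h5] at hm hu
          have : i' ≠ k := by rintro rfl; simp at hu
          exact C.region W.cap (j := i') (by omega) (by omega) (C.nex _) (Or.inl rfl) hm
        · exact C.region W.cap (j := k + 1) (by omega) (by omega) hux (Or.inr ⟨hu2, hxu⟩) hm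
      obtain ⟨m', h3, h4, h5⟩ := this
      refine ⟨m', ?_, h5⟩
      simp only [List.mem_cons, List.not_mem_nil, or_false]; omega)
    (fun m hm hm2 => by
      obtain ⟨m', h3, h4, h5, -, h6⟩ := W.arc1 C (j := k + 1) (by omega) (by omega) hm
      rw [← h5] at hm2
      have : m' ≠ k := by rintro rfl; simp at hm2
      refine ⟨m', ?_, h5⟩
      simp only [List.mem_cons, List.not_mem_nil, or_false]; omega) 6 (by simp)
  have := C.deg3 (v (k + 1))
  have : ({x, v k} : Finset V).card ≤ 2 := Finset.card_le_two
  omega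

/-- A nonterminal vertex seeing three consecutive inner terminals is impossible. -/
theorem Viol.caseI (C : Cfg G x t v) {k n : ℤ} (W : Viol G x t v k n) (hn : 5 ≤ n) {j : ℤ}
    (hj1 : k + 2 ≤ j) (hj2 : j + 2 ≤ k + n) {w : V}
    (hwx : w ≠ x) (hw : ¬ G.Adj x w) (hw1 : G.Adj (v (j - 1)) w) (hw2 : G.Adj (v j) w)
    (hw3 : G.Adj (v (j + 1)) w) : False := by
  classical
  have hnt := W.n3
  have ht := C.t18
  have harc : ∀ m, G.Adj (v j) (v m) → (v (j + 1) = v m ∧ G.Adj (v j) (v (j + 1))) ∨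
      (v (j - 1) = v m ∧ G.Adj (v j) (v (j - 1))) := by
    intro m hm
    obtain ⟨m', h3, h4, h5, h7, h6⟩ := W.arc1 C (j := j) (by omega) (by omega) hm
    rcases h6 with rfl | rfl
    · exact Or.inl ⟨h5, h7⟩
    · exact Or.inr ⟨h5, h7⟩
  have hB : ∀ u, u ∉ ({x, w} : Finset V) → G.Adj (v j) u → u ≠ x → ∀ m, G.Adj u (v m) →
      (v (j - 1) = v m ∨ v j = v m ∨ v (j + 1) = v m) ∨
      (v (j + 2) = v m ∧ G.Adj (v j) (v (j + 1))) ∨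
      (v (j - 2) = v m ∧ G.Adj (v j) (v (j - 1))) := by
    intro u hu hu2 hux m hm
    simp only [Finset.mem_insert, Finset.mem_singleton, not_or] at hu
    by_cases hxu : G.Adj x u
    · obtain ⟨i, rfl⟩ := C.surj u hxu
      rcases harc i hu2 with ⟨h1, h2⟩ | ⟨h1, h2⟩
      · rw [← h1] at hm
        obtain ⟨m', h3, h4, h5, h7, h6⟩ := W.arc1 C (j := j + 1) (by omega) (by omega) hm
        rcases h6 with rfl | rfl
        · rw [show j + 1 + 1 = j + 2 by ring] at h5
          exact Or.inr (Or.inl ⟨h5, h2⟩)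
        · rw [show j + 1 - 1 = j by ring] at h5
          exact Or.inl (Or.inr (Or.inl h5))
      · rw [← h1] at hm
        obtain ⟨m', h3, h4, h5, h7, h6⟩ := W.arc1 C (j := j - 1) (by omega) (by omega) hm
        rcases h6 with rfl | rfl
        · rw [show j - 1 + 1 = j by ring] at h5
          exact Or.inl (Or.inr (Or.inl h5))
        · rw [show j - 1 - 1 = j - 2 by ring] at h5
          exact Or.inr (Or.inr ⟨h5, h2⟩)
    · left
      obtain ⟨m', h3, h4, h5⟩ := C.rep (j - 1) m
      rw [← h5] at hm ⊢
      by_cases hle : m' ≤ j + 1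
      · have : m' = j - 1 ∨ m' = j ∨ m' = j + 1 := by omega
        rcases this with rfl | rfl | rfl <;> simp
      · exfalso
        refine C.nc (j - 1) j (j + 1) m' (by omega) (by omega) (by omega) h4 w u hwx hux
          (Or.inr hw1) hw3.symm (Or.inr hu2) hm (fun h => hu.2 h.symm) ?_ ?_ ?_ ?_ <;>
        · rintro rfl
          first
          | exact hw (C.adj _)
          | exact hxu (C.adj _)
  have hF : ({x, w} : Finset V).card ≤ 2 := Finset.card_le_two
  have hd := C.deg3 (v j)
  by_cases hp : G.Adj (v j) (v (j + 1)) <;> by_cases hm : G.Adj (v j) (v (j - 1))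
  · obtain ⟨e1, e2⟩ := C.curvF j {x, w} [j - 2, j - 1, j, j + 1, j + 2] [j - 1, j + 1]
      (by simp) (by simp) (fun m h => by
        rcases harc m h with h | h <;> simp [h.1])
      (fun u h1 h2 h3 m h4 => by
        rcases hB u h1 h2 h3 m h4 with (h | h | h) | h | h <;> simp [h])
      (fun m h _ => by
        rcases harc m h with h | h <;> simp [h.1]) 8 (by simp)
    have h4 : ({x, w, v (j + 1), v (j - 1)} : Finset V) ⊆ G.neighborFinset (v j) := by
      intro u hu
      simp only [Finset.mem_insert, Finset.mem_singleton] at hu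
      rw [SimpleGraph.mem_neighborFinset]
      rcases hu with rfl | rfl | rfl | rfl
      · exact (C.adj _).symm
      · exact hw2
      · exact hp
      · exact hm
    have h5 := Finset.card_le_card h4
    have n1 : w ≠ v (j + 1) := by rintro rfl; exact hw (C.adj _)
    have n2 : w ≠ v (j - 1) := by rintro rfl; exact hw (C.adj _)
    have n3 : v (j + 1) ≠ v (j - 1) := (C.ne (by omega) (by omega)).symm
    rw [SimpleGraph.card_neighborFinset_eq_degree,
      Finset.card_eq_of_equiv_fin (n := 4) ?_] at h5
    · omega
    · refine Finset.equivFinOfCardEq ?_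
      rw [Finset.card_insert_of_notMem, Finset.card_insert_of_notMem, Finset.card_pair n3]
      · simp [n1, n2]
      · simp [hwx.symm, (C.nex (j + 1)).symm, (C.nex (j - 1)).symm]
  · obtain ⟨e1, e2⟩ := C.curvF j {x, w} [j - 1, j, j + 1, j + 2] [j + 1]
      (by simp) (by simp) (fun m h => by
        rcases harc m h with h | h
        · simp [h.1]
        · exact absurd h.2 hm)
      (fun u h1 h2 h3 m h4 => by
        rcases hB u h1 h2 h3 m h4 with (h | h | h) | h | h
        · simp [h]
        · simp [h]
        · simp [h]
        · simp [h]
        · exact absurd h.2 hm)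
      (fun m h _ => by
        rcases harc m h with h | h
        · simp [h.1]
        · exact absurd h.2 hm) 6 (by simp)
    omega
  · obtain ⟨e1, e2⟩ := C.curvF j {x, w} [j - 1, j, j + 1, j - 2] [j - 1]
      (by simp) (by simp) (fun m h => by
        rcases harc m h with h | h
        · exact absurd h.2 hp
        · simp [h.1])
      (fun u h1 h2 h3 m h4 => by
        rcases hB u h1 h2 h3 m h4 with (h | h | h) | h | h
        · simp [h]
        · simp [h]
        · simp [h]
        · exact absurd h.2 hp
        · simp [h])
      (fun m h _ => by
        rcases harc m h with h | h
        · exact absurd h.2 hp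
        · simp [h.1]) 6 (by simp)
    omega
  · obtain ⟨e1, e2⟩ := C.curvF j {x, w} [j - 1, j, j + 1] []
      (by simp) (by simp) (fun m h => by
        rcases harc m h with h | h
        · exact absurd h.2 hp
        · exact absurd h.2 hm)
      (fun u h1 h2 h3 m h4 => by
        rcases hB u h1 h2 h3 m h4 with (h | h | h) | h | h
        · simp [h]
        · simp [h]
        · simp [h]
        · exact absurd h.2 hp
        · exact absurd h.2 hm)
      (fun m h _ => by
        rcases harc m h with h | h
        · exact absurd h.2 hp
        · exact absurd h.2 hm) 4 (by simp)
    omega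

theorem Viol.false (C : Cfg G x t v) {k n : ℤ} (W : Viol G x t v k n) : False := by
  classical
  have hnt := W.n3
  have hn4 := W.n4
  by_cases h3 : n = 3
  · subst h3; exact W.not3 C
  have hn : 5 ≤ n := by omega
  have harc : ∀ m, G.Adj (v (k + 2)) (v m) → ∃ m' ∈ [k + 1, k + 3], v m' = v m := by
    intro m hm
    obtain ⟨m', h3, h4, h5, h7, h6⟩ := W.arc1 C (j := k + 2) (by omega) (by omega) hm
    refine ⟨m', ?_, h5⟩
    simp only [List.mem_cons, List.not_mem_nil, or_false]; omega
  obtain ⟨e1, e2⟩ := C.curvF (k + 2) {x} [k, k + 1, k + 2, k + 3, k + 4] [k + 1, k + 3]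
    (by simp) (by simp) (fun m hm => by
      obtain ⟨m', h3, h5⟩ := harc m hm
      refine ⟨m', ?_, h5⟩
      simp only [List.mem_cons, List.not_mem_nil, or_false] at h3 ⊢; omega) (by
      intro u hu hu2 hux m hm
      have : ∃ m', k ≤ m' ∧ m' ≤ k + 4 ∧ v m' = v m := by
        by_cases hxu : G.Adj x u
        · obtain ⟨i, rfl⟩ := C.surj u hxu
          obtain ⟨i', h3, h5⟩ := harc i hu2
          rw [← h5] at hm
          simp only [List.mem_cons, List.not_mem_nil, or_false] at h3
          obtain ⟨m', h3', h4, h5, h7, h6⟩ := W.arc1 C (j := i') (by omega) (by omega) hm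
          exact ⟨m', by omega, by omega, h5⟩
        · obtain ⟨m', h3, h4, h5⟩ :=
            C.region W.cap (j := k + 2) (by omega) (by omega) hux (Or.inr ⟨hu2, hxu⟩) hm
          refine ⟨m', h3, ?_, h5⟩
          by_contra hlt
          rw [← h5] at hm
          have f1 := W.contig C (p := k + 2) (q := m') (by omega) (by omega) h4 (by omega)
            hux hxu hu2 hm.symm
          have f2 := W.contig C (p := k + 2 + 1) (q := m') (by omega) (by omega) h4 (by omega)
            hux hxu f1 hm.symm
          refine W.caseI C hn (j := k + 2 + 1) (by omega) (by omega) hux hxu ?_ f1 f2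
          rw [add_sub_cancel_right]; exact hu2
      obtain ⟨m', h3, h4, h5⟩ := this
      refine ⟨m', ?_, h5⟩
      simp only [List.mem_cons, List.not_mem_nil, or_false]; omega)
    (fun m hm _ => harc m hm) 8 (by simp)
  have := C.deg3 (v (k + 2))
  simp only [Finset.card_singleton] at e2
  omega

theorem Cfg.claim_aux (C : Cfg G x t v) (n : ℕ) : ∀ k, Cap G x t v k (k + n) →
    n = 1 ∨ n = 2 ∨ n = 4 := by
  induction n using Nat.strong_induction_on with
  | _ n ih =>
    intro k hk
    by_contra hcon
    refine Viol.false C (k := k) (n := n) ⟨by omega, by omega, by omega, hk, ?_⟩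
    intro a b ha hb hab hcap
    have h1 := hcap.1
    have h2 : b = a + ((b - a).toNat : ℤ) := by omega
    have := ih (b - a).toNat (by omega) a (by rw [← h2]; exact hcap)
    omega

theorem Cfg.claim (C : Cfg G x t v) {a b : ℤ} (h : Cap G x t v a b) :
    b = a + 1 ∨ b = a + 2 ∨ b = a + 4 := by
  have h1 := h.1
  have h2 : b = a + ((b - a).toNat : ℤ) := by omega
  have := C.claim_aux (b - a).toNat a (by rw [← h2]; exact h)
  omega

theorem Cfg.no_arc (C : Cfg G x t v) (a b : ℤ) : ¬ G.Adj (v a) (v b) := by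
  intro h
  obtain ⟨b', h1, h2, h3⟩ := C.rep a b
  rw [← h3] at h
  have ht := C.t18
  have hne : b' ≠ a := by rintro rfl; exact G.irrefl h
  have c1 := C.claim (Cfg.cap_arc (x := x) (t := t) (by omega : a < b') h2 h)
  have c2 := C.claim (Cfg.cap_arc (x := x) (t := t) (by omega : b' < a + t) (by omega)
    (by rw [C.per]; exact h.symm))
  omega

theorem Cfg.cap_one (C : Cfg G x t v) {a b : ℤ} (h : Cap G x t v a b) : b = a + 1 := by
  rcases C.claim h with h1 | h1 | h1
  · exact h1
  · subst h1; exact (C.no_arc _ _ (C.two_cap h).2.1).elim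
  · subst h1; exact (C.no_arc _ _ (C.four_cap h).1).elim

theorem Cfg.contig (C : Cfg G x t v) {p q : ℤ} {u : V} (hpq : p < q) (hqt : q < p + t)
    (hux : u ≠ x) (hu : ¬ G.Adj x u) (hp : G.Adj (v p) u) (hq : G.Adj (v q) u) :
    G.Adj (v (p + 1)) u := by
  obtain ⟨q', e1, e2, e3, e4⟩ := C.cap_of_common hpq hqt hux hu hp hq
  rw [← C.cap_one e4]; exact e3

theorem Cfg.full (C : Cfg G x t v) {m : ℤ} {u : V} (hux : u ≠ x) (hu0 : G.Adj (v 0) u)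
    (hm : G.Adj u (v m)) (hne : v m ≠ v 0) :
    ¬ G.Adj x u ∧ G.Adj (v 1) u ∧ G.Adj (v 2) u ∧ G.Adj (v 3) u := by
  have ht := C.t18
  have hu : ¬ G.Adj x u := by
    intro h
    obtain ⟨i, rfl⟩ := C.surj u h
    exact C.no_arc _ _ hu0
  obtain ⟨m', h1, h2, h3⟩ := C.rep 0 m
  rw [← h3] at hm hne
  have : m' ≠ 0 := by rintro rfl; exact hne rfl
  have ht0 : G.Adj (v t) u := by
    have := C.per 0
    rw [zero_add] at this
    rw [this]; exact hu0
  have f1 := C.contig (p := 0) (q := m') (by omega) (by omega) hux hu hu0 hm.symm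
  have f2 := C.contig (p := 0 + 1) (q := t) (by omega) (by omega) hux hu f1 ht0
  have f3 := C.contig (p := 0 + 1 + 1) (q := t) (by omega) (by omega) hux hu f2 ht0
  norm_num at f1 f2 f3
  exact ⟨hu, f1, f2, f3⟩

theorem Cfg.false (C : Cfg G x t v) : False := by
  classical
  have ht := C.t18
  have hF : ∃ F : Finset V, x ∈ F ∧ F.card ≤ 2 ∧ ∀ u, u ∉ F → G.Adj (v 0) u → u ≠ x →
      ∀ m, G.Adj u (v m) → v m = v 0 := by
    by_cases h : ∃ w m, w ≠ x ∧ G.Adj (v 0) w ∧ G.Adj w (v m) ∧ v m ≠ v 0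
    · obtain ⟨w, m, hwx, hw0, hwm, hne⟩ := h
      obtain ⟨g0, g1, g2, g3⟩ := C.full hwx hw0 hwm hne
      refine ⟨{x, w}, by simp, Finset.card_le_two, ?_⟩
      intro u hu hu0 hux i hi
      by_contra hne'
      obtain ⟨k0, k1, k2, k3⟩ := C.full hux hu0 hi hne'
      simp only [Finset.mem_insert, Finset.mem_singleton, not_or] at hu
      refine C.nc 0 1 2 3 (by omega) (by omega) (by omega) (by omega) w u hwx hux (Or.inr hw0)
        g2.symm (Or.inr k1) k3.symm (fun h => hu.2 h.symm) ?_ ?_ ?_ ?_ <;>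
      · rintro rfl
        first
        | exact g0 (C.adj _)
        | exact k0 (C.adj _)
    · refine ⟨{x}, by simp, by simp, ?_⟩
      intro u hu hu0 hux i hi
      by_contra hne'
      exact h ⟨u, i, hux, hu0, hi, hne'⟩
  obtain ⟨F, hx, hc, hF⟩ := hF
  obtain ⟨e1, e2⟩ := C.curvF 0 F [0] [] hx (by simp) (fun m hm => (C.no_arc _ _ hm).elim)
    (fun u h1 h2 h3 m h4 => ⟨0, by simp, (hF u h1 h2 h3 m h4).symm⟩)
    (fun m hm => (C.no_arc _ _ hm).elim) 2 (by simp)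
  have := C.deg3 (v 0)
  omega

end CfgLemmas

theorem no_such_graph (G : SimpleGraph V) [G.LocallyFinite]
    (hconn : G.Connected) (hplanar : IsPlanar G)
    (hmin : ∀ u : V, 3 ≤ G.degree u) (hpos : PositivelyCurved G)
    (x : V) (hdx : 18 ≤ G.degree x) : False := by
  obtain ⟨v, h1, h2, h3, h4, h5⟩ := exists_cyclic_order G hplanar x _ rfl (by omega)
  exact Cfg.false (G := G) (x := x) (t := (G.degree x : ℤ)) (v := v)
    ⟨by exact_mod_cast hdx, h1, h2, h3, h4, h5, hmin, hconn, hpos, rfl⟩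

/-- Claim 3: in a simple connected positively curved planar graph with minimum degree
at least 3, drawn in the plane, if `x` is a max-degree vertex with `deg x ≥ 18` and
`v` enumerates the neighbors of `x` in clockwise order, then there is no `ℓ`-cap with
`ℓ ∉ {1, 2, 4}` (here `1 ≤ ℓ ≤ t - 1` since the cap is formed by a pair of distinct
neighbors, indices taken modulo `t`). -/
theorem no_cap_outside (G : SimpleGraph V) [G.LocallyFinite]
    (hconn : G.Connected) (hplanar : IsPlanar G)
    (hmin : ∀ u : V, 3 ≤ G.degree u) (hpos : PositivelyCurved G)
    (x : V) (hmax : ∀ u : V, G.degree u ≤ G.degree x) (hdx : 18 ≤ G.degree x)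
    (t : ℕ) (ht : t = G.degree x) (v : ℕ → V)
    (hper : ∀ i : ℕ, v (i + t) = v i)
    (hvinj : ∀ i < t, ∀ j < t, v i = v j → i = j)
    (hvmem : ∀ i : ℕ, G.Adj x (v i))
    (hvsurj : ∀ u : V, G.Adj x u → ∃ i < t, v i = u)
    (i ℓ : ℕ) (hℓ₁ : 1 ≤ ℓ) (hℓ₂ : ℓ ≤ t - 1) (hℓ : ℓ ∉ ({1, 2, 4} : Set ℕ)) :
    ¬ IsCap G x v i ℓ := by
  exact (no_such_graph G hconn hplanar hmin hpos x hdx).elim
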